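/- arXiv:1806.10208 — 14 statements merged into one kernel-verified Lean document; each statement's English description precedes it below -/
import Mathlib

section
/- Let n, ℓ ≥ 1, let f : ℝⁿ → ℝⁿ be a C∞ map, and let μ₁, …, μ_ℓ : ℝⁿ → ℝ be C∞ functions. Define F : ℝⁿ → ℝⁿ × ℝ^ℓ by F(x) = (f(x), μ₁(x)·|Jf|(x)², …, μ_ℓ(x)·|Jf|(x)²). Then F is a frontal at 0: there exist C∞ maps φ₁, …, φ_ℓ : ℝⁿ → ℝⁿ × ℝ^ℓ such that (1) for every x ∈ ℝⁿ and every v ∈ ℝⁿ, the Euclidean inner product ⟨φᵢ(x), DF(x)v⟩ equals 0 for all i; (2) φᵢ(0) ≠ 0 for all i; and (3) the vectors φ₁(0), …, φ_ℓ(0) are linearly independent over ℝ. -/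
open scoped ContDiff

/-- The determinant of a matrix with `C^m` entries is `C^m`. -/
theorem contDiff_det_of_entries {E ι : Type*} [NormedAddCommGroup E] [NormedSpace ℝ E]
    [Fintype ι] [DecidableEq ι] {m : WithTop ℕ∞} {M : E → Matrix ι ι ℝ}
    (hM : ∀ i j, ContDiff ℝ m fun x => M x i j) : ContDiff ℝ m fun x => (M x).det := by
  simp only [Matrix.det_apply]
  exact ContDiff.sum fun σ _ => (contDiff_prod fun i _ => hM _ _).const_smul _

/-- The entries of the adjugate of a matrix with `C^m` entries are `C^m`. -/
theorem contDiff_adjugate_of_entries {E ι : Type*} [NormedAddCommGroup E] [NormedSpace ℝ E]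
    [Fintype ι] [DecidableEq ι] {m : WithTop ℕ∞} {M : E → Matrix ι ι ℝ}
    (hM : ∀ i j, ContDiff ℝ m fun x => M x i j) (i j : ι) :
    ContDiff ℝ m fun x => (M x).adjugate i j := by
  simp only [Matrix.adjugate_apply]
  refine contDiff_det_of_entries fun a b => ?_
  by_cases h : a = j
  · subst h
    simpa using contDiff_const
  · simpa [Matrix.updateRow_ne h] using hM a b

/-- Pairing `w ᵥ* adjugate A` with `A v` multiplies `w v` by the determinant. -/
theorem sum_adjugate_mul_apply {ι : Type*} [Fintype ι] [DecidableEq ι]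
    (A : (ι → ℝ) →L[ℝ] (ι → ℝ)) (w : (ι → ℝ) →L[ℝ] ℝ) (v : ι → ℝ) :
    ∑ j, (∑ k, w (Pi.single k 1) * (LinearMap.toMatrix' (A : (ι → ℝ) →ₗ[ℝ] _)).adjugate k j) *
      A v j = A.det * w v := by
  have hw (u : ι → ℝ) : w u = (fun k => w (Pi.single k 1)) ⬝ᵥ u := by
    conv_lhs => rw [pi_eq_sum_univ' u]
    simp [dotProduct, mul_comm]
  have hA : A v = (LinearMap.toMatrix' (A : (ι → ℝ) →ₗ[ℝ] _)).mulVec v := by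
    rw [LinearMap.toMatrix'_mulVec]; rfl
  calc _ = Matrix.vecMul (fun k => w (Pi.single k 1))
        (LinearMap.toMatrix' (A : (ι → ℝ) →ₗ[ℝ] _)).adjugate ⬝ᵥ A v := rfl
    _ = _ := by
      rw [hA, ← Matrix.dotProduct_mulVec, Matrix.mulVec_mulVec, Matrix.adjugate_mul,
        LinearMap.det_toMatrix', Matrix.smul_mulVec, Matrix.one_mulVec, dotProduct_smul, ← hw]
      rfl

/-- For any C∞ map `f : ℝⁿ → ℝⁿ` and C∞ functions `μ₁, …, μ_ℓ`, the map
`F(x) = (f(x), μ₁(x)|Jf|²(x), …, μ_ℓ(x)|Jf|²(x))` is a frontal at `0`. -/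
theorem frontal_of_jacobian_squared (n l : ℕ) (hn : 1 ≤ n) (hl : 1 ≤ l)
    (f : (Fin n → ℝ) → (Fin n → ℝ)) (hf : ContDiff ℝ ∞ f)
    (μ : Fin l → (Fin n → ℝ) → ℝ) (hμ : ∀ i, ContDiff ℝ ∞ (μ i))
    (J : (Fin n → ℝ) → ℝ) (hJ : ∀ x, J x = (fderiv ℝ f x).det)
    (F : (Fin n → ℝ) → (Fin n → ℝ) × (Fin l → ℝ))
    (hF : ∀ x, F x = (f x, fun i => μ i x * (J x) ^ 2)) :
    ∃ φ : Fin l → (Fin n → ℝ) → (Fin n → ℝ) × (Fin l → ℝ),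
      (∀ i, ContDiff ℝ ∞ (φ i)) ∧
      (∀ i, ∀ x, ∀ v : Fin n → ℝ,
        (∑ j, (φ i x).1 j * (fderiv ℝ F x v).1 j)
          + (∑ j, (φ i x).2 j * (fderiv ℝ F x v).2 j) = 0) ∧
      (∀ i, φ i 0 ≠ 0) ∧
      LinearIndependent ℝ (fun i => φ i 0) := by
  have hf' : ContDiff ℝ ∞ (fderiv ℝ f) := hf.fderiv_right (by simp)
  have hM (i j) : ContDiff ℝ ∞ fun x =>
      LinearMap.toMatrix' (fderiv ℝ f x : (Fin n → ℝ) →ₗ[ℝ] (Fin n → ℝ)) i j := by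
    simp only [LinearMap.toMatrix'_apply, ContinuousLinearMap.coe_coe]
    exact contDiff_pi.1 (hf'.clm_apply contDiff_const) i
  have hJs : ContDiff ℝ ∞ J := by
    have h : J = fun x =>
        (LinearMap.toMatrix' (fderiv ℝ f x : (Fin n → ℝ) →ₗ[ℝ] (Fin n → ℝ))).det := by
      funext x
      rw [hJ, LinearMap.det_toMatrix']
    rw [h]
    exact contDiff_det_of_entries hM
  let w (i : Fin l) (x : Fin n → ℝ) : (Fin n → ℝ) →L[ℝ] ℝ :=
    J x • fderiv ℝ (μ i) x + (2 * μ i x) • fderiv ℝ J x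
  have hw (i) : ContDiff ℝ ∞ (w i) :=
    (hJs.smul ((hμ i).fderiv_right (by simp))).add
      ((contDiff_const.mul (hμ i)).smul (hJs.fderiv_right (by simp)))
  have hd (i x) : HasFDerivAt (fun x => μ i x * J x ^ 2) (J x • w i x) x := by
    have h1 := ((hμ i).differentiable (by simp) x).hasFDerivAt
    have h2 := (hJs.differentiable (by simp) x).hasFDerivAt
    refine (h1.mul (h2.pow 2)).congr_fderiv ?_
    ext v
    simp [w]
    ring
  have hFd (x) : HasFDerivAt F
      ((fderiv ℝ f x).prod (ContinuousLinearMap.pi fun i => J x • w i x)) x := by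
    rw [funext hF]
    exact ((hf.differentiable (by simp) x).hasFDerivAt).prodMk (hasFDerivAt_pi.2 fun i => hd i x)
  have hind : LinearIndependent ℝ (fun i : Fin l => (Pi.single i 1 : Fin l → ℝ)) :=
    Pi.linearIndependent_single_one _ _
  refine ⟨fun i x => (fun j => -∑ k, w i x (Pi.single k 1) *
    (LinearMap.toMatrix' (fderiv ℝ f x : (Fin n → ℝ) →ₗ[ℝ] (Fin n → ℝ))).adjugate k j,
      Pi.single i 1),
    fun i => ?_, fun i x v => ?_, fun i h => ?_, ?_⟩
  · refine ContDiff.prodMk (contDiff_pi.2 fun j => ?_) contDiff_const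
    exact (ContDiff.sum fun k _ => ((hw i).clm_apply contDiff_const).mul
      (contDiff_adjugate_of_entries hM k j)).neg
  · rw [(hFd x).fderiv]
    simp only [ContinuousLinearMap.prod_apply, neg_mul, Finset.sum_neg_distrib]
    rw [sum_adjugate_mul_apply, ← hJ]
    simp [Pi.single_apply]
  · simpa using congrFun (congrArg Prod.snd h) i
  · exact LinearIndependent.of_comp (LinearMap.snd ℝ (Fin n → ℝ) (Fin l → ℝ)) hind
end

section
/- Let n ≥ 1, let f : ℝⁿ → ℝⁿ be a C∞ map, and let μ : ℝⁿ → ℝ and η : ℝⁿ → ℝ be C∞ functions. Define φ : ℝⁿ → ℝ by φ(x) = μ(x)·|Jf|(x)² + η(f(x)). Then there exists a C∞ map a : ℝⁿ → ℝⁿ such that for every x ∈ ℝⁿ, dφ(x) = Σⱼ aⱼ(x)·dfⱼ(x), i.e., the gradient ∇φ(x) equals (Df(x))ᵀ · a(x). (Equivalently: ⟨|Jf|²⟩_{E_n} + f*(E_n) is contained in the ramification module R_f of f.) -/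
open scoped ContDiff

theorem ContDiff.matrix_det {𝕜 E ι : Type*} [NontriviallyNormedField 𝕜] [NormedAddCommGroup E]
    [NormedSpace 𝕜 E] [Fintype ι] [DecidableEq ι] {k : WithTop ℕ∞} {M : E → Matrix ι ι 𝕜}
    (hM : ∀ i j, ContDiff 𝕜 k fun x => M x i j) : ContDiff 𝕜 k fun x => (M x).det := by
  simp only [Matrix.det_apply]
  exact ContDiff.sum fun σ _ => (contDiff_prod fun i _ => hM (σ i) i).const_smul _

theorem ContDiff.matrix_adjugate_apply {𝕜 E ι : Type*} [NontriviallyNormedField 𝕜]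
    [NormedAddCommGroup E] [NormedSpace 𝕜 E] [Fintype ι] [DecidableEq ι] {k : WithTop ℕ∞}
    {M : E → Matrix ι ι 𝕜} (hM : ∀ i j, ContDiff 𝕜 k fun x => M x i j) (i j : ι) :
    ContDiff 𝕜 k fun x => (M x).adjugate i j := by
  simp only [Matrix.adjugate_apply]
  refine ContDiff.matrix_det fun p q => ?_
  by_cases hp : p = j
  · subst hp
    simpa using contDiff_const
  · simpa [Matrix.updateRow_ne hp] using hM p q

/-- For a C∞ map `f : ℝⁿ → ℝⁿ` and C∞ functions `μ, η`, the function
`φ(x) = μ(x)|Jf|²(x) + η(f(x))` lies in the ramification module of `f`: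
there is a C∞ map `a : ℝⁿ → ℝⁿ` with `dφ = Σⱼ aⱼ dfⱼ` everywhere. -/
theorem jacobianSq_module_subset_ramification (n : ℕ) (hn : 1 ≤ n)
    (f : (Fin n → ℝ) → (Fin n → ℝ)) (hf : ContDiff ℝ ∞ f)
    (μ η : (Fin n → ℝ) → ℝ) (hμ : ContDiff ℝ ∞ μ) (hη : ContDiff ℝ ∞ η)
    (φ : (Fin n → ℝ) → ℝ)
    (hφ : ∀ x, φ x = μ x * ((fderiv ℝ f x).det) ^ 2 + η (f x)) :
    ∃ a : (Fin n → ℝ) → (Fin n → ℝ), ContDiff ℝ ∞ a ∧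
      ∀ x, ∀ v : Fin n → ℝ,
        fderiv ℝ φ x v = ∑ j, a x j * fderiv ℝ (fun y => f y j) x v := by
  set M : (Fin n → ℝ) → Matrix (Fin n) (Fin n) ℝ :=
    fun x => LinearMap.toMatrix' (fderiv ℝ f x : (Fin n → ℝ) →ₗ[ℝ] (Fin n → ℝ)) with hMdef
  have partial_smooth {F : Type} [NormedAddCommGroup F] [NormedSpace ℝ F]
      {g : (Fin n → ℝ) → F} (hg : ContDiff ℝ ∞ g) (v : Fin n → ℝ) :
      ContDiff ℝ ∞ fun x => fderiv ℝ g x v :=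
    (hg.fderiv_right (m := ∞) (by simp)).clm_apply contDiff_const
  have hM : ∀ i j, ContDiff ℝ ∞ fun x => M x i j := fun i j => by
    simpa [hMdef, LinearMap.toMatrix'_apply] using
      contDiff_pi.1 (partial_smooth hf (Pi.single j 1)) i
  have hdet : ∀ x, (fderiv ℝ f x).det = (M x).det := fun x =>
    (LinearMap.det_toMatrix' _).symm
  set J : (Fin n → ℝ) → ℝ := fun x => (M x).det with hJdef
  have hJ : ContDiff ℝ ∞ J := ContDiff.matrix_det hM
  set ρ : (Fin n → ℝ) → (Fin n → ℝ) := fun x i =>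
    J x * fderiv ℝ μ x (Pi.single i 1) + 2 * μ x * fderiv ℝ J x (Pi.single i 1) with hρdef
  have hρ : ∀ i, ContDiff ℝ ∞ fun x => ρ x i := fun i =>
    (hJ.mul (partial_smooth hμ _)).add ((contDiff_const.mul hμ).mul (partial_smooth hJ _))
  refine ⟨fun x => Matrix.vecMul (ρ x) (M x).adjugate +
    fun j => fderiv ℝ η (f x) (Pi.single j 1), ?_, fun x v => ?_⟩
  · refine contDiff_pi.2 fun j => ContDiff.add ?_ ((partial_smooth hη _).comp hf)
    simp only [Matrix.vecMul, dotProduct]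
    exact ContDiff.sum fun i _ => (hρ i).mul (ContDiff.matrix_adjugate_apply hM i j)
  have apply_eq_sum (L : (Fin n → ℝ) →L[ℝ] ℝ) (w : Fin n → ℝ) :
      L w = (fun i => L (Pi.single i 1)) ⬝ᵥ w := by
    conv_lhs => rw [pi_eq_sum_univ' w]
    simp [dotProduct, mul_comm]
  have hfd := (hf.differentiable (by simp)) x
  have hcomp : ∀ j, fderiv ℝ (fun y => f y j) x v = fderiv ℝ f x v j := fun j => by
    rw [fderiv_apply hfd]
    rfl
  have hMv : fderiv ℝ f x v = Matrix.mulVec (M x) v :=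
    (LinearMap.toMatrix'_mulVec _ v).symm
  have hφ' : φ = fun x => μ x * J x ^ 2 + η (f x) := funext fun x => by rw [hφ, hdet]
  have hdφ : fderiv ℝ φ x v = J x * (ρ x ⬝ᵥ v) + fderiv ℝ η (f x) (fderiv ℝ f x v) := by
    have hμd := ((hμ.differentiable (by simp)) x).hasFDerivAt
    have hJd := ((hJ.differentiable (by simp)) x).hasFDerivAt
    have hηd := ((hη.differentiable (by simp)) (f x)).hasFDerivAt
    have hρv : ρ x ⬝ᵥ v = J x * fderiv ℝ μ x v + 2 * μ x * fderiv ℝ J x v := by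
      rw [apply_eq_sum (fderiv ℝ μ x), apply_eq_sum (fderiv ℝ J x)]
      simp only [hρdef, dotProduct, Finset.mul_sum, ← Finset.sum_add_distrib]
      exact Finset.sum_congr rfl fun i _ => by ring
    have hd := ((hμd.mul (hJd.pow 2)).add (hηd.comp x hfd.hasFDerivAt)).fderiv
    change fderiv ℝ (fun x => μ x * J x ^ 2 + η (f x)) x = _ at hd
    rw [hφ', hd, hρv]
    simp
    ring
  have hadj : Matrix.vecMul (ρ x) (M x).adjugate ⬝ᵥ Matrix.mulVec (M x) v =
      J x * (ρ x ⬝ᵥ v) := by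
    rw [Matrix.dotProduct_mulVec, Matrix.vecMul_vecMul, Matrix.adjugate_mul,
      ← Matrix.dotProduct_mulVec, Matrix.smul_mulVec, Matrix.one_mulVec, dotProduct_smul,
      smul_eq_mul]
  simp only [hcomp]
  change _ = (_ + _) ⬝ᵥ fderiv ℝ f x v
  rw [add_dotProduct, hdφ, ← apply_eq_sum, hMv, hadj]
end

section
/- Let g : ℝ → ℝ be given by g(x) = x²/2, and let φ : ℝ → ℝ be a C∞ function such that there exist a neighborhood U of 0 and a C∞ function a : ℝ → ℝ with φ'(x) = a(x)·x for all x ∈ U. Then there exist a neighborhood V of 0 and C∞ functions μ : ℝ → ℝ and η : ℝ → ℝ such that φ(x) = μ(x)·x² + η(x²/2) for all x ∈ V. (This is the case n = 1, dim Q(f) = 2 of the equality ⟨|Jf|²⟩_{E_n} + f*(E_n) = R_f, since |Jg|(x)² = x².) -/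
open scoped ContDiff

open intervalIntegral MeasureTheory in
/-- Differentiation under the integral sign for the weighted radial average of a `C¹` function. -/
theorem hasDerivAt_integral_pow_mul_comp_mul {a : ℝ → ℝ} (ha : ContDiff ℝ 1 a) (k : ℕ) (x : ℝ) :
    HasDerivAt (fun y => ∫ t in (0 : ℝ)..1, t ^ k * a (y * t))
      (∫ t in (0 : ℝ)..1, t ^ (k + 1) * deriv a (x * t)) x := by
  have hca : Continuous a := ha.continuous
  have hcd : Continuous (deriv a) := ha.continuous_deriv le_rfl
  have hF' : Continuous (fun p : ℝ × ℝ => p.2 ^ (k + 1) * deriv a (p.1 * p.2)) := by fun_prop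
  obtain ⟨C, hC⟩ := ((isCompact_closedBall x 1).prod (isCompact_Icc (a := (0 : ℝ)) (b := 1)))
    |>.exists_bound_of_continuousOn hF'.continuousOn
  refine (hasDerivAt_integral_of_dominated_loc_of_deriv_le (bound := fun _ => C)
    (F := fun y t => t ^ k * a (y * t)) (F' := fun y t => t ^ (k + 1) * deriv a (y * t))
    (Metric.closedBall_mem_nhds x one_pos) ?_ ?_ ?_ ?_ intervalIntegrable_const ?_).2
  · exact .of_forall fun y => Continuous.aestronglyMeasurable (by fun_prop)
  · exact Continuous.intervalIntegrable (by fun_prop) _ _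
  · exact Continuous.aestronglyMeasurable (by fun_prop)
  · refine .of_forall fun t ht y hy => hC (y, t) ⟨hy, ?_⟩
    rw [Set.uIoc_of_le zero_le_one] at ht
    exact Set.Ioc_subset_Icc_self ht
  · refine .of_forall fun t _ y _ => ?_
    have hd : HasDerivAt a (deriv a (y * t)) (y * t) :=
      (ha.differentiable one_ne_zero _).hasDerivAt
    have := (hd.comp y ((hasDerivAt_id y).mul_const t)).const_mul (t ^ k)
    exact this.congr_deriv (by ring)

theorem contDiff_integral_pow_mul_comp_mul {a : ℝ → ℝ} (ha : ContDiff ℝ ∞ a) (k : ℕ) :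
    ContDiff ℝ ∞ (fun x => ∫ t in (0 : ℝ)..1, t ^ k * a (x * t)) := by
  refine contDiff_infty.2 fun n => ?_
  have one_le : (1 : ℕ∞ω) ≤ ∞ := by exact_mod_cast le_top
  induction n generalizing a k with
  | zero =>
    have := ha.continuous
    exact contDiff_zero.2 (by fun_prop)
  | succ n ih =>
    have hd := hasDerivAt_integral_pow_mul_comp_mul (ha.of_le one_le) k
    push_cast
    refine contDiff_succ_iff_deriv.2 ⟨fun x => (hd x).differentiableAt, by simp, ?_⟩
    rw [funext fun x => (hd x).deriv]
    exact ih (contDiff_infty_iff_deriv.1 ha).2 (k + 1)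

/-- If `φ : ℝ → ℝ` is C∞ and `φ'(x) = a(x)·x` near `0` for some C∞ `a`,
then near `0` one can write `φ(x) = μ(x)x² + η(x²/2)` with `μ, η` C∞.
(Case `n = 1`, `dim Q(f) = 2` of `⟨|Jf|²⟩ + f*(E_n) = R_f` for `g(x) = x²/2`.) -/
theorem ramification_eq_case_fold_dim_one
    (φ : ℝ → ℝ) (hφ : ContDiff ℝ ∞ φ)
    (U : Set ℝ) (hU : U ∈ nhds (0 : ℝ))
    (a : ℝ → ℝ) (ha : ContDiff ℝ ∞ a)
    (hda : ∀ x ∈ U, deriv φ x = a x * x) :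
    ∃ (V : Set ℝ) (μ η : ℝ → ℝ),
      V ∈ nhds (0 : ℝ) ∧ ContDiff ℝ ∞ μ ∧ ContDiff ℝ ∞ η ∧
      ∀ x ∈ V, φ x = μ x * x ^ 2 + η (x ^ 2 / 2) := by
  obtain ⟨ε, hε, hball⟩ := Metric.mem_nhds_iff.1 hU
  refine ⟨Metric.ball 0 ε, fun x => ∫ t in (0 : ℝ)..1, t ^ 1 * a (x * t), fun _ => φ 0,
    Metric.ball_mem_nhds 0 hε, contDiff_integral_pow_mul_comp_mul ha 1, contDiff_const, ?_⟩
  intro x hx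
  have hsub : Set.uIcc 0 x ⊆ U :=
    ((convex_ball (0 : ℝ) ε).ordConnected.uIcc_subset (Metric.mem_ball_self hε) hx).trans hball
  have hca := ha.continuous
  have hftc : ∫ s in (0 : ℝ)..x, a s * s = φ x - φ 0 := by
    refine intervalIntegral.integral_eq_sub_of_hasDerivAt (fun s hs => ?_)
      (Continuous.intervalIntegrable (by fun_prop) _ _)
    rw [← hda s (hsub hs)]
    exact (hφ.differentiable (by simp) s).hasDerivAt
  have hscale : x * ∫ t in (0 : ℝ)..1, a (x * t) * (x * t) = ∫ s in (0 : ℝ)..x, a s * s := by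
    simpa using intervalIntegral.mul_integral_comp_mul_left (a := 0) (b := 1)
      (f := fun s => a s * s) x
  have hfactor : ∫ t in (0 : ℝ)..1, a (x * t) * (x * t)
      = x * ∫ t in (0 : ℝ)..1, t ^ 1 * a (x * t) := by
    rw [← intervalIntegral.integral_const_mul]
    exact intervalIntegral.integral_congr fun t _ => by ring
  rw [hfactor, hftc] at hscale
  linear_combination -hscale
end

section
/- Let n ≥ 2, let α : ℝ^{n−1} → ℝ be a C∞ function with α(0) = 0, and define g : ℝ × ℝ^{n−1} → ℝ × ℝ^{n−1} by g(x, λ) = (x²/2 + α(λ)x, λ). Let φ : ℝⁿ → ℝ be a C∞ function such that there exist a neighborhood U of 0 and C∞ functions a₁, …, aₙ on U with dφ = Σⱼ aⱼ·dgⱼ on U (equivalently, ∂φ/∂x(x,λ) = a₁(x,λ)·(x + α(λ)) on U). Then there exist a neighborhood V of 0, a C∞ function μ : ℝⁿ → ℝ and a C∞ function η : ℝⁿ → ℝ such that φ(x, λ) = μ(x, λ)·(x + α(λ))² + η(g(x, λ)) for all (x, λ) ∈ V. (This is the case dim Q(g) = 2 of the equality ⟨|Jg|²⟩_{E_n} +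 g*(E_n) = R_g; note |Jg|(x,λ) = x + α(λ).) -/
open scoped ContDiff

/-- Differentiation under the integral sign for a jointly `C¹` integrand. -/
theorem ContDiff.hasFDerivAt_intervalIntegral {H E : Type*}
    [NormedAddCommGroup H] [NormedSpace ℝ H] [ProperSpace H]
    [NormedAddCommGroup E] [NormedSpace ℝ E]
    {F : H × ℝ → E} (hF : ContDiff ℝ 1 F) (s t : ℝ) (x₀ : H) :
    HasFDerivAt (fun x => ∫ τ in s..t, F (x, τ))
      (∫ τ in s..t, (fderiv ℝ F (x₀, τ)).comp (ContinuousLinearMap.inl ℝ H ℝ)) x₀ := by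
  have hcont : Continuous fun p : H × ℝ =>
      (fderiv ℝ F p).comp (ContinuousLinearMap.inl ℝ H ℝ) :=
    (hF.continuous_fderiv one_ne_zero).clm_comp continuous_const
  obtain ⟨C, hC⟩ := ((isCompact_closedBall x₀ 1).prod
    (isCompact_uIcc (a := s) (b := t))).exists_bound_of_continuousOn hcont.continuousOn
  refine intervalIntegral.hasFDerivAt_integral_of_dominated_of_fderiv_le
    (F := fun x τ => F (x, τ)) (bound := fun _ => C)
    (F' := fun x τ => (fderiv ℝ F (x, τ)).comp (ContinuousLinearMap.inl ℝ H ℝ))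
    (Metric.closedBall_mem_nhds x₀ one_pos) ?_ ?_ ?_ ?_ ?_ ?_
  · exact .of_forall fun x =>
      (hF.continuous.comp (Continuous.prodMk_right x)).aestronglyMeasurable
  · exact (hF.continuous.comp (Continuous.prodMk_right x₀)).intervalIntegrable _ _
  · exact (hcont.comp (Continuous.prodMk_right x₀)).aestronglyMeasurable
  · exact .of_forall fun τ hτ x hx => hC (x, τ) ⟨hx, Set.uIoc_subset_uIcc hτ⟩
  · exact intervalIntegrable_const
  · exact .of_forall fun τ _ x _ =>
      (hF.differentiable one_ne_zero (x, τ)).hasFDerivAt.comp x (hasFDerivAt_prodMk_left x τ)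

/-- The integral over a compact interval of a jointly `Cⁿ` function is `Cⁿ` in the parameter. -/
theorem ContDiff.intervalIntegral_of_nat.{u} {H : Type u}
    [NormedAddCommGroup H] [NormedSpace ℝ H] [ProperSpace H] (s t : ℝ) (n : ℕ) :
    ∀ {E : Type u} [NormedAddCommGroup E] [NormedSpace ℝ E] {F : H × ℝ → E},
      ContDiff ℝ n F → ContDiff ℝ n fun x => ∫ τ in s..t, F (x, τ) := by
  induction n with
  | zero =>
    intro E _ _ F hF
    rw [Nat.cast_zero, contDiff_zero] at hF ⊢
    exact intervalIntegral.continuous_parametric_intervalIntegral_of_continuous'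
      (f := fun x τ => F (x, τ)) hF s t
  | succ n ih =>
    intro E _ _ F hF
    rw [Nat.cast_succ] at hF ⊢
    exact contDiff_succ_iff_hasFDerivAt.2 ⟨_,
      ih ((hF.fderiv_right le_rfl).clm_comp contDiff_const),
      (hF.of_le le_add_self).hasFDerivAt_intervalIntegral s t⟩

/-- The integral over a compact interval of a jointly smooth function is smooth in the
parameter. -/
theorem ContDiff.intervalIntegral_of_infty.{u} {H E : Type u}
    [NormedAddCommGroup H] [NormedSpace ℝ H] [ProperSpace H]
    [NormedAddCommGroup E] [NormedSpace ℝ E] {F : H × ℝ → E} (hF : ContDiff ℝ ∞ F) (s t : ℝ) :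
    ContDiff ℝ ∞ fun x => ∫ τ in s..t, F (x, τ) :=
  contDiff_infty.2 fun n => .intervalIntegral_of_nat s t n (contDiff_infty.1 hF n)

/-- The derivative of `(x, λ) ↦ x² / 2 + α(λ) x` in the direction of `x` is `x + α(λ)`. -/
theorem fderiv_fold_apply_inl {L : Type*} [NormedAddCommGroup L] [NormedSpace ℝ L]
    {α : L → ℝ} {p : ℝ × L} (hα : DifferentiableAt ℝ α p.2) (y : ℝ) :
    fderiv ℝ (fun q : ℝ × L => q.1 ^ 2 / 2 + α q.2 * q.1) p (y, 0) = (p.1 + α p.2) * y := by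
  have hfst : HasFDerivAt (fun q : ℝ × L => q.1) (ContinuousLinearMap.fst ℝ ℝ L) p :=
    hasFDerivAt_fst
  have hα' : HasFDerivAt (fun q : ℝ × L => α q.2)
      ((fderiv ℝ α p.2).comp (ContinuousLinearMap.snd ℝ ℝ L)) p :=
    hα.hasFDerivAt.comp p hasFDerivAt_snd
  have hg : HasFDerivAt (fun q : ℝ × L => q.1 ^ 2 / 2 + α q.2 * q.1) _ p :=
    ((hfst.pow 2).mul_const (2⁻¹ : ℝ)).add (hα'.mul hfst)
  rw [hg.fderiv]
  simp
  ring

/-- If `∂φ/∂x = a · (x + α(λ))` along the segment from `(-α(λ), λ)` to `p = (x, λ)`, then `φ p`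
differs from `φ (-α(λ), λ)` by a multiple of `(x + α(λ))²`. -/
theorem eq_integral_mul_sq_add_of_fderiv_inl {L : Type*} [NormedAddCommGroup L] [NormedSpace ℝ L]
    {φ a : ℝ × L → ℝ} (hφ : Differentiable ℝ φ) (ha : Continuous a) (c : ℝ) (p : ℝ × L)
    (h : ∀ t ∈ Set.Icc (0 : ℝ) 1, ∀ y, fderiv ℝ φ (-c + t * (p.1 + c), p.2) (y, 0) =
      a (-c + t * (p.1 + c), p.2) * (t * (p.1 + c)) * y) :
    φ p = (∫ t in (0 : ℝ)..1, t * a (-c + t * (p.1 + c), p.2)) * (p.1 + c) ^ 2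
      + φ (-c, p.2) := by
  have hline (t : ℝ) : HasDerivAt (fun t : ℝ => ((-c + t * (p.1 + c), p.2) : ℝ × L))
      (p.1 + c, 0) t := by
    refine HasDerivAt.prodMk ?_ (hasDerivAt_const t p.2)
    simpa using ((hasDerivAt_id t).mul_const (p.1 + c)).const_add (-c)
  have hderiv : ∀ t ∈ Set.uIcc (0 : ℝ) 1,
      HasDerivAt (fun t : ℝ => φ (-c + t * (p.1 + c), p.2))
        (t * a (-c + t * (p.1 + c), p.2) * (p.1 + c) ^ 2) t := by
    intro t ht
    rw [Set.uIcc_of_le zero_le_one] at ht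
    have hcomp := (hφ _).hasFDerivAt.comp_hasDerivAt t (hline t)
    rw [h t ht] at hcomp
    exact hcomp.congr_deriv (by ring)
  have hint := intervalIntegral.integral_eq_sub_of_hasDerivAt hderiv
    (Continuous.intervalIntegrable (by fun_prop) _ _)
  rw [intervalIntegral.integral_mul_const] at hint
  rw [hint]
  simp

/-- Let `g(x, λ) = (x²/2 + α(λ)x, λ)` with `α(0) = 0`. If `φ` is C∞ and
`dφ = a·dg₁ + Σⱼ bⱼ·dλⱼ` near `0` with C∞ coefficients, then near `0`,
`φ(x,λ) = μ(x,λ)(x + α(λ))² + η(g(x,λ))` with `μ, η` C∞. -/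
theorem ramification_eq_case_fold (n : ℕ) (hn : 2 ≤ n)
    (α : (Fin (n - 1) → ℝ) → ℝ) (hα : ContDiff ℝ ∞ α) (hα0 : α 0 = 0)
    (φ : ℝ × (Fin (n - 1) → ℝ) → ℝ) (hφ : ContDiff ℝ ∞ φ)
    (U : Set (ℝ × (Fin (n - 1) → ℝ))) (hU : U ∈ nhds (0 : ℝ × (Fin (n - 1) → ℝ)))
    (a : ℝ × (Fin (n - 1) → ℝ) → ℝ) (ha : ContDiff ℝ ∞ a)
    (b : Fin (n - 1) → ℝ × (Fin (n - 1) → ℝ) → ℝ) (hb : ∀ j, ContDiff ℝ ∞ (b j))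
    (hd : ∀ p ∈ U, ∀ v : ℝ × (Fin (n - 1) → ℝ),
      fderiv ℝ φ p v =
        a p * fderiv ℝ (fun q : ℝ × (Fin (n - 1) → ℝ) => q.1 ^ 2 / 2 + α q.2 * q.1) p v
        + ∑ j, b j p * fderiv ℝ (fun q : ℝ × (Fin (n - 1) → ℝ) => q.2 j) p v) :
    ∃ (V : Set (ℝ × (Fin (n - 1) → ℝ)))
      (μ : ℝ × (Fin (n - 1) → ℝ) → ℝ) (η : ℝ × (Fin (n - 1) → ℝ) → ℝ),
      V ∈ nhds (0 : ℝ × (Fin (n - 1) → ℝ)) ∧ ContDiff ℝ ∞ μ ∧ ContDiff ℝ ∞ η ∧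
      ∀ p ∈ V, φ p = μ p * (p.1 + α p.2) ^ 2 + η (p.1 ^ 2 / 2 + α p.2 * p.1, p.2) := by
  have hcont : Continuous fun p : ℝ × (Fin (n - 1) → ℝ) => (-α p.2, p.2) := by
    have := hα.continuous
    fun_prop
  obtain ⟨r, hr, hball⟩ := Metric.mem_nhds_iff.1 hU
  refine ⟨Metric.ball 0 r ∩ (fun p => (-α p.2, p.2)) ⁻¹' Metric.ball 0 r,
    fun p => ∫ t in (0 : ℝ)..1, t * a (-α p.2 + t * (p.1 + α p.2), p.2),
    fun p => φ (-α p.2, p.2), ?_, ?_, ?_, ?_⟩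
  · refine Filter.inter_mem (Metric.ball_mem_nhds 0 hr) (hcont.continuousAt.preimage_mem_nhds ?_)
    have hzero : ((-α 0, 0) : ℝ × (Fin (n - 1) → ℝ)) = 0 := by simp [hα0]
    exact Metric.isOpen_ball.mem_nhds (by simp [hzero, hr])
  · exact ContDiff.intervalIntegral_of_infty
      (F := fun q : (ℝ × (Fin (n - 1) → ℝ)) × ℝ =>
        q.2 * a (-α q.1.2 + q.2 * (q.1.1 + α q.1.2), q.1.2)) (by fun_prop) 0 1
  · fun_prop
  · rintro p ⟨hp, hp'⟩
    refine eq_integral_mul_sq_add_of_fderiv_inl (hφ.differentiable (by simp)) ha.continuous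
      (α p.2) p fun t ht y => ?_
    have hmem : (-α p.2 + t * (p.1 + α p.2), p.2) ∈ U := by
      refine hball ?_
      convert (convex_ball (0 : ℝ × (Fin (n - 1) → ℝ)) r).add_smul_sub_mem hp' hp ht using 1
      ext <;> simp
    have hproj (j : Fin (n - 1)) (q : ℝ × (Fin (n - 1) → ℝ)) :
        fderiv ℝ (fun q : ℝ × (Fin (n - 1) → ℝ) => q.2 j) q (y, 0) = 0 := by
      have : HasFDerivAt (fun q : ℝ × (Fin (n - 1) → ℝ) => q.2 j)
          ((ContinuousLinearMap.proj j).comp (ContinuousLinearMap.snd ℝ ℝ (Fin (n - 1) → ℝ))) q :=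
        ((ContinuousLinearMap.proj (R := ℝ) (φ := fun _ : Fin (n - 1) => ℝ) j).comp
          (ContinuousLinearMap.snd ℝ ℝ (Fin (n - 1) → ℝ))).hasFDerivAt
      simp [this.fderiv]
    rw [hd _ hmem, fderiv_fold_apply_inl (hα.differentiable (by simp) _)]
    simp only [hproj, mul_zero, Finset.sum_const_zero]
    ring
end

section
/- Let n ≥ 2, let α : ℝ^{n−1} → ℝ be a C∞ function with α(0) = 0, and define g : ℝ × ℝ^{n−1} → ℝ × ℝ^{n−1} by g(x, λ) = (x³/3 + α(λ)x, λ). Let φ : ℝⁿ → ℝ be a C∞ function such that there exist a neighborhood U of 0 and C∞ functions a₁, …, aₙ on U with dφ = Σⱼ aⱼ·dgⱼ on U (equivalently, ∂φ/∂x(x,λ) = a₁(x,λ)·(x² + α(λ)) on U). Then there exist a neighborhood V of 0, a C∞ function μ : ℝⁿ → ℝ and a C∞ function η : ℝⁿ → ℝ such that φ(x, λ) = μ(x, λ)·(x² + α(λ))² + η(g(x, λ)) for all (x, λ) ∈ V. (This is the case dim Q(g) = 3 of the equality ⟨|Jg|²⟩_{E_n} + g*(E_n) = R_g; note |Jg|(x,λ)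 = x² + α(λ).) -/
open scoped ContDiff

section SmoothParameters

variable {E : Type*} [NormedAddCommGroup E] [NormedSpace ℝ E]

/-- The integral over a compact interval of a smooth function depends smoothly on parameters. -/
lemma contDiff_intervalIntegral_param [FiniteDimensional ℝ E] {F : E × ℝ → ℝ}
    (hF : ContDiff ℝ ∞ F) (a b : ℝ) : ContDiff ℝ ∞ fun x => ∫ s in a..b, F (x, s) := by
  rw [contDiff_infty]
  intro n
  induction n generalizing F with
  | zero =>
    rw [Nat.cast_zero, contDiff_zero]
    exact intervalIntegral.continuous_parametric_intervalIntegral_of_continuous'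
      (f := fun x s => F (x, s)) (by simpa [Function.uncurry_def] using hF.continuous) a b
  | succ n ih =>
    have hcont : Continuous fun p => (fderiv ℝ F p).comp (ContinuousLinearMap.inl ℝ E ℝ) :=
      (hF.continuous_fderiv (by simp)).clm_comp continuous_const
    have key : ∀ x, HasFDerivAt (fun x => ∫ s in a..b, F (x, s))
        (∫ s in a..b, (fderiv ℝ F (x, s)).comp (ContinuousLinearMap.inl ℝ E ℝ)) x := by
      intro x
      obtain ⟨U, hU, hUx⟩ := exists_compact_mem_nhds x
      obtain ⟨M, hM⟩ := (hU.prod (isCompact_uIcc (a := a) (b := b))).bddAbove_image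
        hcont.norm.continuousOn
      refine intervalIntegral.hasFDerivAt_integral_of_dominated_of_fderiv_le
        (F := fun x s => F (x, s)) (bound := fun _ => M) hUx ?_ ?_ ?_ ?_ ?_ ?_
        (F' := fun x s => (fderiv ℝ F (x, s)).comp (ContinuousLinearMap.inl ℝ E ℝ))
      · exact .of_forall fun y =>
          (hF.continuous.comp (by fun_prop : Continuous fun s : ℝ => (y, s))).aestronglyMeasurable
      · exact (hF.continuous.comp
          (by fun_prop : Continuous fun s : ℝ => (x, s))).intervalIntegrable _ _
      · exact (hcont.comp (by fun_prop : Continuous fun s : ℝ => (x, s))).aestronglyMeasurable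
      · exact .of_forall fun s hs y hy =>
          hM ⟨(y, s), ⟨hy, Set.uIoc_subset_uIcc hs⟩, rfl⟩
      · exact intervalIntegrable_const
      · refine .of_forall fun s _ y _ => ?_
        exact ((hF.differentiable (by simp) (y, s)).hasFDerivAt).comp y
          (hasFDerivAt_prodMk_left y s)
    push_cast
    rw [contDiff_succ_iff_fderiv_apply]
    refine ⟨fun x => (key x).differentiableAt, by simp, fun v => ?_⟩
    have : (fun x => fderiv ℝ (fun x => ∫ s in a..b, F (x, s)) x v) =
        fun x => ∫ s in a..b, fderiv ℝ F (x, s) (v, 0) := by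
      ext x
      have hint : IntervalIntegrable
          (fun s => (fderiv ℝ F (x, s)).comp (ContinuousLinearMap.inl ℝ E ℝ))
          MeasureTheory.volume a b :=
        (hcont.comp (by fun_prop : Continuous fun s : ℝ => (x, s))).intervalIntegrable _ _
      rw [(key x).fderiv, ContinuousLinearMap.intervalIntegral_apply hint]
      simp
    rw [this]
    exact ih (F := fun p => fderiv ℝ F p (v, 0))
      ((hF.fderiv_right (by simp)).clm_apply contDiff_const)

/-- Partial derivative of a smooth function in its first, real, variable. -/
lemma ContDiff.hasDerivAt_fst {F : ℝ × E → ℝ} (hF : ContDiff ℝ ∞ F) (t : ℝ) (e : E) :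
    HasDerivAt (fun s => F (s, e)) (fderiv ℝ F (t, e) (1, 0)) t :=
  (hF.differentiable (by simp) (t, e)).hasFDerivAt.comp_hasDerivAt t
    ((hasDerivAt_id t).prodMk (hasDerivAt_const t e))

lemma ContDiff.fderiv_apply_const {F : E → ℝ} (hF : ContDiff ℝ ∞ F) (v : E) :
    ContDiff ℝ ∞ fun p => fderiv ℝ F p v :=
  (hF.fderiv_right (by simp)).clm_apply contDiff_const

/-- A smooth family of functions on the line has a smooth family of primitives. -/
lemma exists_contDiff_primitive [FiniteDimensional ℝ E] {f : ℝ × E → ℝ} (hf : ContDiff ℝ ∞ f) :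
    ∃ F : ℝ × E → ℝ, ContDiff ℝ ∞ F ∧ (∀ e, F (0, e) = 0) ∧
      ∀ t e, HasDerivAt (fun s => F (s, e)) (f (t, e)) t := by
  refine ⟨fun p => p.1 * ∫ s in (0 : ℝ)..1, f (p.1 * s, p.2), ?_, by simp, fun t e => ?_⟩
  · exact contDiff_fst.mul (contDiff_intervalIntegral_param
      (F := fun q : (ℝ × E) × ℝ => f (q.1.1 * q.2, q.1.2)) (hf.comp (by fun_prop)) 0 1)
  · have hc : Continuous fun s => f (s, e) := hf.continuous.comp (by fun_prop)
    have := intervalIntegral.integral_hasDerivAt_right (hc.intervalIntegrable 0 t)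
      (hc.stronglyMeasurableAtFilter _ _) hc.continuousAt
    refine this.congr_of_eventuallyEq (.of_forall fun s => ?_)
    simp [intervalIntegral.mul_integral_comp_mul_left (f := fun s => f (s, e))]

/-- Hadamard's lemma with parameters. -/
lemma exists_contDiff_eq_add_mul [FiniteDimensional ℝ E] {F : ℝ × E → ℝ}
    (hF : ContDiff ℝ ∞ F) :
    ∃ G : ℝ × E → ℝ, ContDiff ℝ ∞ G ∧ ∀ t e, F (t, e) = F (0, e) + t * G (t, e) := by
  refine ⟨fun p => ∫ s in (0 : ℝ)..1, fderiv ℝ F (p.1 * s, p.2) (1, 0), ?_, fun t e => ?_⟩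
  · exact contDiff_intervalIntegral_param
      (F := fun q : (ℝ × E) × ℝ => fderiv ℝ F (q.1.1 * q.2, q.1.2) (1, 0))
      ((hF.fderiv_apply_const (1, 0)).comp (by fun_prop)) 0 1
  · have hc : Continuous fun s => fderiv ℝ F (s, e) (1, 0) :=
      (hF.fderiv_apply_const (1, 0)).continuous.comp (by fun_prop)
    have h := intervalIntegral.integral_eq_sub_of_hasDerivAt
      (fun s _ => hF.hasDerivAt_fst s e) (hc.intervalIntegrable 0 t)
    simp [intervalIntegral.mul_integral_comp_mul_left (f := fun s => fderiv ℝ F (s, e) (1, 0)), h]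

end SmoothParameters

section FlatFunctions

variable {E : Type*} [NormedAddCommGroup E] [NormedSpace ℝ E]

/-- A function of `(t, e)` is flat if it is smoothly divisible by every power of `t`. -/
def IsFlat (R : ℝ × E → ℝ) : Prop :=
  ∀ k : ℕ, ∃ G : ℝ × E → ℝ, ContDiff ℝ ∞ G ∧ ∀ p, R p = p.1 ^ k * G p

namespace IsFlat

variable {R S : ℝ × E → ℝ}

lemma contDiff (hR : IsFlat R) : ContDiff ℝ ∞ R := by
  obtain ⟨G, hG, h⟩ := hR 0
  have : R = G := by ext p; simp [h p]
  rwa [this]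

lemma eq_zero (hR : IsFlat R) (e : E) : R (0, e) = 0 := by
  obtain ⟨G, -, h⟩ := hR 1
  simp [h]

lemma add (hR : IsFlat R) (hS : IsFlat S) : IsFlat fun p => R p + S p := by
  intro k
  obtain ⟨G, hG, h⟩ := hR k
  obtain ⟨H, hH, h'⟩ := hS k
  exact ⟨fun p => G p + H p, hG.add hH, fun p => by simp only [h, h']; ring⟩

lemma const_mul (c : ℝ) (hR : IsFlat R) : IsFlat fun p => c * R p := by
  intro k
  obtain ⟨G, hG, h⟩ := hR k
  exact ⟨fun p => c * G p, contDiff_const.mul hG, fun p => by simp only [h]; ring⟩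

lemma comp_neg (hR : IsFlat R) : IsFlat fun p => R (-p.1, p.2) := by
  intro k
  obtain ⟨G, hG, h⟩ := hR k
  refine ⟨fun p => (-1) ^ k * G (-p.1, p.2),
    contDiff_const.mul (hG.comp (contDiff_fst.neg.prodMk contDiff_snd)), fun p => ?_⟩
  simp only [h, neg_pow p.1]
  ring

lemma fderiv_apply (hR : IsFlat R) (v : ℝ × E) : IsFlat fun p => fderiv ℝ R p v := by
  intro k
  obtain ⟨G, hG, h⟩ := hR (k + 1)
  refine ⟨fun p => (k + 1) * v.1 * G p + p.1 * fderiv ℝ G p v,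
    (contDiff_const.mul hG).add (contDiff_fst.mul (hG.fderiv_apply_const v)), fun p => ?_⟩
  have h1 : HasFDerivAt R _ p :=
    (((hasFDerivAt_fst (𝕜 := ℝ) (p := p)).pow (k + 1)).mul
      (hG.differentiable (by simp) p).hasFDerivAt).congr_of_eventuallyEq (.of_forall h)
  simp only [h1.fderiv]
  simp
  ring

lemma exists_eq_mul (hR : IsFlat R) : ∃ G : ℝ × E → ℝ, IsFlat G ∧ ∀ p, R p = p.1 * G p := by
  obtain ⟨G, hG, h⟩ := hR 1
  refine ⟨G, fun k => ?_, by simpa using h⟩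
  obtain ⟨H, hH, h'⟩ := hR (k + 1)
  refine ⟨H, hH, ?_⟩
  have hd : Dense {p : ℝ × E | p.1 ≠ 0} :=
    (dense_compl_singleton (0 : ℝ)).preimage isOpenMap_fst
  refine fun p => congrFun (Continuous.ext_on hd hG.continuous
    ((continuous_fst.pow k).mul hH.continuous) fun q hq => ?_) p
  have := (h q).symm.trans (h' q)
  refine mul_left_cancel₀ (show q.1 ≠ 0 from hq) ?_
  simp only [Pi.mul_apply, Pi.pow_apply]
  linear_combination this

lemma sqrt_pow_four_le {w w' : ℝ} (h : w ≤ 0) : √w' ^ 4 ≤ |w' - w| ^ 2 := by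
  rcases le_total w' 0 with h' | h'
  · rw [Real.sqrt_eq_zero_of_nonpos h']; simp [sq_nonneg]
  · rw [show √w' ^ 4 = (√w' ^ 2) ^ 2 by ring, Real.sq_sqrt h', sq_abs]
    nlinarith

lemma hasFDerivAt_comp_sqrt_of_nonpos (hR : IsFlat R) {p : ℝ × E} (hp : p.1 ≤ 0) :
    HasFDerivAt (fun p : ℝ × E => R (√p.1, p.2)) (0 : ℝ × E →L[ℝ] ℝ) p := by
  obtain ⟨G, hG, h⟩ := hR 4
  have hc : Continuous fun q : ℝ × E => G (√q.1, q.2) :=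
    hG.continuous.comp (by fun_prop)
  have h1 : (fun q : ℝ × E => √q.1 ^ 4) =O[nhds p] fun q => ‖q - p‖ ^ 2 := by
    refine .of_norm_le fun q => ?_
    rw [Real.norm_of_nonneg (by positivity)]
    refine (sqrt_pow_four_le hp).trans ?_
    gcongr
    exact norm_fst_le (q - p)
  have h2 := h1.mul ((hc.tendsto p).isBigO_one ℝ)
  have h3 : (fun q : ℝ × E => ‖q - p‖ ^ 2) =o[nhds p] fun q => q - p := by
    have := (Asymptotics.isLittleO_norm_pow_id (E' := ℝ × E) one_lt_two).comp_tendsto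
      (k := fun q : ℝ × E => q - p) (l' := nhds p)
      (by simpa using ((continuous_sub_right p).tendsto p))
    exact this
  refine .of_isLittleO ?_
  simp only [h, Real.sqrt_eq_zero_of_nonpos hp]
  refine (Asymptotics.IsBigO.trans_isLittleO ?_ h3)
  simpa using h2

lemma differentiableAt_and_fderiv_comp_sqrt (hR : IsFlat R) {G : ℝ × E → ℝ} (hG : IsFlat G)
    (hRG : ∀ p, fderiv ℝ R p (1, 0) = p.1 * G p) (p : ℝ × E) :
    DifferentiableAt ℝ (fun p : ℝ × E => R (√p.1, p.2)) p ∧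
    ∀ v, fderiv ℝ (fun p : ℝ × E => R (√p.1, p.2)) p v =
      v.1 / 2 * G (√p.1, p.2) + fderiv ℝ R (√p.1, p.2) (0, v.2) := by
  rcases le_or_gt p.1 0 with hp | hp
  · have h := hR.hasFDerivAt_comp_sqrt_of_nonpos hp
    refine ⟨h.differentiableAt, fun v => ?_⟩
    rw [h.fderiv, Real.sqrt_eq_zero_of_nonpos hp, hG.eq_zero,
      (hR.fderiv_apply (0, v.2)).eq_zero]
    simp
  · have h : HasFDerivAt (fun p : ℝ × E => R (√p.1, p.2)) _ p :=
      (hR.contDiff.differentiable (by simp) (√p.1, p.2)).hasFDerivAt.comp p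
        (((hasFDerivAt_fst (𝕜 := ℝ) (p := p)).sqrt hp.ne').prodMk hasFDerivAt_snd)
    refine ⟨h.differentiableAt, fun v => ?_⟩
    have hs : √p.1 ≠ 0 := (Real.sqrt_pos.2 hp).ne'
    have hv : ((v.1 / (2 * √p.1), v.2) : ℝ × E) = (v.1 / (2 * √p.1)) • (1, 0) + (0, v.2) := by
      simp
    have : fderiv ℝ (fun p : ℝ × E => R (√p.1, p.2)) p v =
        fderiv ℝ R (√p.1, p.2) (v.1 / (2 * √p.1), v.2) := by
      rw [h.fderiv]
      simp [div_eq_inv_mul]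
    rw [this, hv, map_add, map_smul, hRG, smul_eq_mul]
    field_simp

/-- A flat function of `t` becomes a smooth function of `w` under `t = √w`, extended by zero. -/
lemma contDiff_comp_sqrt [FiniteDimensional ℝ E] (hR : IsFlat R) :
    ContDiff ℝ ∞ fun p : ℝ × E => R (√p.1, p.2) := by
  rw [contDiff_infty]
  intro n
  induction n generalizing R with
  | zero =>
    rw [Nat.cast_zero, contDiff_zero]
    exact hR.contDiff.continuous.comp (by fun_prop)
  | succ n ih =>
    obtain ⟨G, hG, hRG⟩ := (hR.fderiv_apply (1, 0)).exists_eq_mul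
    have key := hR.differentiableAt_and_fderiv_comp_sqrt hG hRG
    push_cast
    rw [contDiff_succ_iff_fderiv_apply]
    refine ⟨fun p => (key p).1, by simp, fun v => ?_⟩
    simp only [fun p => (key p).2 v]
    exact ih ((hG.const_mul (v.1 / 2)).add (hR.fderiv_apply (0, v.2)))

/-- A flat function is a combination of `1` and `t` over the smooth functions of `t ^ 2`. -/
lemma exists_eq_even_add_odd [FiniteDimensional ℝ E] (hR : IsFlat R) :
    ∃ P Q : ℝ × E → ℝ, ContDiff ℝ ∞ P ∧ ContDiff ℝ ∞ Q ∧
      ∀ t e, R (t, e) = P (t ^ 2, e) + t * Q (t ^ 2, e) := by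
  obtain ⟨G, hG, hRG⟩ := hR.exists_eq_mul
  refine ⟨_, _, ((hR.add hR.comp_neg).const_mul (1 / 2)).contDiff_comp_sqrt,
    ((hG.add hG.comp_neg).const_mul (1 / 2)).contDiff_comp_sqrt, fun t e => ?_⟩
  simp only [Real.sqrt_sq_eq_abs, hRG]
  rcases abs_choice t with h | h <;> rw [h] <;> simp <;> ring

end IsFlat

end FlatFunctions

section BorelLemma

variable {E : Type*} [NormedAddCommGroup E] [NormedSpace ℝ E]

/-- The derivatives of a smooth compactly supported function are bounded. -/
lemma ContDiff.exists_norm_iteratedFDeriv_le {F : E → ℝ} (hF : ContDiff ℝ ∞ F)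
    (hc : HasCompactSupport F) (i : ℕ) : ∃ C, ∀ x, ‖iteratedFDeriv ℝ i F x‖ ≤ C :=
  (hF.continuous_iteratedFDeriv (m := i) (by exact_mod_cast le_top)).bounded_above_of_compact_support
    (hc.iteratedFDeriv i)

/-- Stretching the first variable by `N ≥ 1` multiplies `i`-th derivatives by at most `N ^ i`. -/
lemma norm_iteratedFDeriv_comp_stretch_le {F : ℝ × E → ℝ} (hF : ContDiff ℝ ∞ F) {N : ℝ}
    (hN : 1 ≤ N) {i : ℕ} {C : ℝ} (hC : ∀ x, ‖iteratedFDeriv ℝ i F x‖ ≤ C) (p : ℝ × E) :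
    ‖iteratedFDeriv ℝ i (fun p : ℝ × E => F (N * p.1, p.2)) p‖ ≤ C * N ^ i := by
  let L : ℝ × E →L[ℝ] ℝ × E :=
    (N • ContinuousLinearMap.fst ℝ ℝ E).prod (ContinuousLinearMap.snd ℝ ℝ E)
  have hL : ‖L‖ ≤ N := by
    refine L.opNorm_le_bound (by linarith) fun x => ?_
    refine norm_prod_le_iff.2 ⟨?_, ?_⟩
    · simp only [L, ContinuousLinearMap.prod_apply, smul_apply, norm_smul,
        Real.norm_of_nonneg (zero_le_one.trans hN)]
      gcongr
      exact norm_fst_le x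
    · exact (norm_snd_le x).trans (le_mul_of_one_le_left (norm_nonneg _) hN)
  have h := L.iteratedFDeriv_comp_right hF p (i := i) (by exact_mod_cast le_top)
  have e : F ∘ L = fun p : ℝ × E => F (N * p.1, p.2) := rfl
  rw [← e, h]
  refine (ContinuousMultilinearMap.norm_compContinuousLinearMap_le _ _).trans ?_
  have hC0 : 0 ≤ C := (norm_nonneg _).trans (hC 0)
  simp only [Finset.prod_const, Finset.card_univ, Fintype.card_fin]
  gcongr
  exact hC _

/-- A monomial with coefficient `c`, cut off outside `|w| ≤ 2 / N`. -/
def cutoffMonomial (χ : ℝ → ℝ) (c : E → ℝ) (m : ℕ) (N : ℝ) (p : ℝ × E) : ℝ :=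
  c p.2 * p.1 ^ m * χ (N * p.1)

lemma contDiff_cutoffMonomial {χ : ℝ → ℝ} (hχ : ContDiff ℝ ∞ χ) {c : E → ℝ}
    (hc : ContDiff ℝ ∞ c) (m : ℕ) (N : ℝ) : ContDiff ℝ ∞ (cutoffMonomial χ c m N) :=
  ((hc.comp contDiff_snd).mul (contDiff_fst.pow m)).mul
    (hχ.comp (contDiff_const.mul contDiff_fst))

/-- The derivatives of order less than `m` of cut off monomials of degree `m` are `O(1 / N)`. -/
lemma exists_norm_iteratedFDeriv_cutoffMonomial_le {χ : ℝ → ℝ} (hχ : ContDiff ℝ ∞ χ)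
    (hχc : HasCompactSupport χ) {c : E → ℝ} (hc : ContDiff ℝ ∞ c) (hcc : HasCompactSupport c)
    (m i : ℕ) (hi : i < m) : ∃ C, ∀ N : ℝ, 1 ≤ N → ∀ p,
      ‖iteratedFDeriv ℝ i (cutoffMonomial χ c m N) p‖ * N ≤ C := by
  have hsm := contDiff_cutoffMonomial hχ hc m 1
  have hcs : HasCompactSupport (cutoffMonomial χ c m 1) := by
    refine HasCompactSupport.intro (hχc.isCompact.prod hcc.isCompact) fun p hp => ?_
    rw [Set.mem_prod, not_and_or] at hp
    rcases hp with hp | hp <;> simp [cutoffMonomial, image_eq_zero_of_notMem_tsupport hp]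
  obtain ⟨C, hC⟩ := hsm.exists_norm_iteratedFDeriv_le hcs i
  have hC0 : 0 ≤ C := (norm_nonneg _).trans (hC 0)
  refine ⟨C, fun N hN p => ?_⟩
  have hN0 : 0 < N := by linarith
  have e : cutoffMonomial χ c m N =
      fun p => (N ^ m)⁻¹ • (fun p : ℝ × E => cutoffMonomial χ c m 1 (N * p.1, p.2)) p := by
    ext p
    simp only [cutoffMonomial, smul_eq_mul, mul_pow]
    field_simp
  have hs : ContDiff ℝ ∞ (fun p : ℝ × E => cutoffMonomial χ c m 1 (N * p.1, p.2)) :=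
    hsm.comp (by fun_prop)
  rw [e, iteratedFDeriv_const_smul_apply' (hs.of_le (by exact_mod_cast le_top)).contDiffAt,
    norm_smul, Real.norm_of_nonneg (by positivity)]
  have h1 := norm_iteratedFDeriv_comp_stretch_le hsm hN hC p
  calc _ ≤ (N ^ m)⁻¹ * (C * N ^ i) * N := by gcongr
    _ = C * (N ^ (i + 1) / N ^ m) := by field_simp; ring
    _ ≤ C * 1 := by
      gcongr
      rw [div_le_one (by positivity)]
      exact pow_le_pow_right₀ hN hi
    _ = C := mul_one C

/-- The remainder of cutting off a monomial is divisible by every power. -/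
lemma exists_contDiff_cutoff_remainder {χ : ℝ → ℝ} (hχ : ContDiff ℝ ∞ χ)
    (hχ1 : χ =ᶠ[nhds 0] 1) (k K : ℕ) (N : ℝ) :
    ∃ ρ : ℝ → ℝ, ContDiff ℝ ∞ ρ ∧ ∀ w, w ^ k * χ (N * w) = w ^ k + w ^ K * ρ w := by
  have h0 : ∀ᶠ w : ℝ in nhds 0, χ (N * w) = 1 := by
    have : Filter.Tendsto (fun w : ℝ => N * w) (nhds 0) (nhds 0) := by
      simpa using (continuous_const_mul N).tendsto 0
    exact this.eventually hχ1
  refine ⟨fun w => w ^ k * (χ (N * w) - 1) / w ^ K, ?_, fun w => ?_⟩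
  · rw [contDiff_iff_contDiffAt]
    intro w
    rcases eq_or_ne w 0 with rfl | hw
    · refine (contDiffAt_const (c := (0 : ℝ))).congr_of_eventuallyEq ?_
      filter_upwards [h0] with w hw
      simp [hw]
    · refine ContDiffAt.div ?_ (contDiffAt_id.pow K) (pow_ne_zero _ hw)
      exact (contDiffAt_id.pow k).mul
        (((hχ.comp (contDiff_const.mul contDiff_id)).sub contDiff_const).contDiffAt)
  · rcases eq_or_ne w 0 with rfl | hw
    · simp [show χ 0 = 1 by simpa using h0.self_of_nhds]
    · field_simp
      ring

/-- Borel's lemma with parameters. -/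
lemma exists_contDiff_taylor_eq [FiniteDimensional ℝ E] (c : ℕ → E → ℝ)
    (hc : ∀ k, ContDiff ℝ ∞ (c k)) (hcc : ∀ k, HasCompactSupport (c k)) :
    ∃ B : ℝ × E → ℝ, ContDiff ℝ ∞ B ∧ ∀ K : ℕ, ∃ G : ℝ × E → ℝ, ContDiff ℝ ∞ G ∧
      ∀ p, B p = ∑ k ∈ Finset.range K, c k p.2 * p.1 ^ k + p.1 ^ K * G p := by
  let χ : ContDiffBump (0 : ℝ) := ⟨1, 2, one_pos, one_lt_two⟩
  have hχ : ContDiff ℝ ∞ χ := χ.contDiff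
  have hχc : HasCompactSupport χ := χ.hasCompactSupport
  choose! C hC using fun k m i (hi : i < m) =>
    exists_norm_iteratedFDeriv_cutoffMonomial_le hχ hχc (hc k) (hcc k) m i hi
  have hN : ∀ k, ∃ N : ℝ, 1 ≤ N ∧ ∀ m ≤ k, ∀ i < m, ∀ p,
      ‖iteratedFDeriv ℝ i (cutoffMonomial χ (c k) m N) p‖ ≤ (1 / 2) ^ k := by
    intro k
    let S := ∑ m ∈ Finset.range (k + 1), ∑ i ∈ Finset.range m, |C k m i| * 2 ^ k
    have hS : 0 ≤ S := by positivity
    refine ⟨1 + S, by linarith, fun m hm i hi p => ?_⟩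
    have h1 : |C k m i| * 2 ^ k ≤ S :=
      (Finset.single_le_sum (f := fun i => |C k m i| * 2 ^ k) (fun _ _ => by positivity)
        (Finset.mem_range.2 hi)).trans
      (Finset.single_le_sum (f := fun m => ∑ i ∈ Finset.range m, |C k m i| * 2 ^ k)
        (fun _ _ => by positivity) (Finset.mem_range.2 (Nat.lt_succ_of_le hm)))
    have h2 := hC k m i hi (1 + S) (by linarith) p
    have h3 := le_abs_self (C k m i)
    refine le_of_mul_le_mul_right (h2.trans ?_) (by linarith : 0 < 1 + S)
    rw [one_div, inv_pow, inv_mul_eq_div, le_div_iff₀ (by positivity)]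
    nlinarith [pow_pos (two_pos (α := ℝ)) k]
  choose N hN1 hN using hN
  let G : ℕ → ℝ × E → ℝ := fun K p => ∑' k, cutoffMonomial χ (c (k + K)) k (N (k + K)) p
  have hbound : ∀ K i : ℕ, ∀ᶠ k : ℕ in Filter.cofinite, ∀ p,
      ‖iteratedFDeriv ℝ i (cutoffMonomial χ (c (k + K)) k (N (k + K))) p‖ ≤ (1 / 2) ^ k := by
    intro K i
    rw [Nat.cofinite_eq_atTop]
    filter_upwards [Filter.eventually_gt_atTop i] with k hk p
    exact (hN (k + K) k (by omega) i hk p).trans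
      (pow_le_pow_of_le_one (by norm_num) (by norm_num) (by omega))
  have hG : ∀ K, ContDiff ℝ ∞ (G K) := fun K =>
    contDiff_tsum_of_eventually (v := fun _ k => (1 / 2) ^ k)
      (fun k => contDiff_cutoffMonomial hχ (hc _) _ _) (fun _ _ => summable_geometric_two)
      (fun i _ => hbound K i)
  have hsum : ∀ p, Summable fun k => cutoffMonomial χ (c k) k (N k) p := fun p =>
    Summable.of_norm_bounded_eventually summable_geometric_two <| by
      filter_upwards [hbound 0 0] with k hk
      simpa using hk p
  refine ⟨G 0, hG 0, fun K => ?_⟩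
  choose ρ hρ hρe using fun k =>
    exists_contDiff_cutoff_remainder hχ χ.eventuallyEq_one k K (N k)
  refine ⟨fun p => ∑ k ∈ Finset.range K, c k p.2 * ρ k p.1 + G K p, ?_, fun p => ?_⟩
  · exact (ContDiff.sum fun k _ => ((hc k).comp contDiff_snd).mul
      ((hρ k).comp contDiff_fst)).add (hG K)
  · have h1 : G 0 p = ∑ k ∈ Finset.range K, cutoffMonomial χ (c k) k (N k) p +
        ∑' k, cutoffMonomial χ (c (k + K)) (k + K) (N (k + K)) p :=
      ((hsum p).sum_add_tsum_nat_add K).symm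
    have h2 : ∑' k, cutoffMonomial χ (c (k + K)) (k + K) (N (k + K)) p = p.1 ^ K * G K p := by
      rw [← tsum_mul_left]
      refine tsum_congr fun k => ?_
      simp only [cutoffMonomial]
      ring
    rw [h1, h2, mul_add, Finset.mul_sum, ← add_assoc, ← Finset.sum_add_distrib]
    congr 1
    refine Finset.sum_congr rfl fun k _ => ?_
    simp only [cutoffMonomial]
    rw [mul_assoc, hρe]
    ring

/-- Near each parameter, a smooth function of `t` is a combination of `1` and `t` over the smooth
functions of `t ^ 2`. -/
lemma exists_eq_even_add_odd [FiniteDimensional ℝ E] {h : ℝ × E → ℝ} (hh : ContDiff ℝ ∞ h) :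
    ∃ P Q : ℝ × E → ℝ, ContDiff ℝ ∞ P ∧ ContDiff ℝ ∞ Q ∧
      ∀ᶠ e in nhds (0 : E), ∀ t, h (t, e) = P (t ^ 2, e) + t * Q (t ^ 2, e) := by
  let χ : ContDiffBump (0 : E) := ⟨1, 2, one_pos, one_lt_two⟩
  have hχ : ContDiff ℝ ∞ χ := χ.contDiff
  have hdiv : ∀ f : {f : ℝ × E → ℝ // ContDiff ℝ ∞ f}, ∃ g : {f : ℝ × E → ℝ // ContDiff ℝ ∞ f},
      ∃ c d : E → ℝ, ContDiff ℝ ∞ c ∧ ContDiff ℝ ∞ d ∧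
        ∀ t e, f.1 (t, e) = c e + d e * t + t ^ 2 * g.1 (t, e) := by
    rintro ⟨f, hf⟩
    obtain ⟨f₁, hf₁, h₁⟩ := exists_contDiff_eq_add_mul hf
    obtain ⟨f₂, hf₂, h₂⟩ := exists_contDiff_eq_add_mul hf₁
    refine ⟨⟨f₂, hf₂⟩, fun e => f (0, e), fun e => f₁ (0, e), hf.comp (by fun_prop),
      hf₁.comp (by fun_prop), fun t e => ?_⟩
    simp only
    rw [h₁, h₂]
    ring
  choose T c d hc hd hT using hdiv
  let f : ℕ → {f : ℝ × E → ℝ // ContDiff ℝ ∞ f} := fun k => T^[k] ⟨h, hh⟩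
  have hf : ∀ K t e, h (t, e) = ∑ k ∈ Finset.range K, c (f k) e * (t ^ 2) ^ k +
      t * ∑ k ∈ Finset.range K, d (f k) e * (t ^ 2) ^ k + (t ^ 2) ^ K * (f K).1 (t, e) := by
    intro K t e
    induction K with
    | zero => simp [f]
    | succ K ih =>
      have e1 : f (K + 1) = T (f K) := Function.iterate_succ_apply' _ _ _
      rw [ih, hT (f K), e1, Finset.sum_range_succ, Finset.sum_range_succ]
      ring
  obtain ⟨A, hA, hAe⟩ := exists_contDiff_taylor_eq (fun k e => χ e * c (f k) e)
    (fun k => hχ.mul (hc _)) (fun k => χ.hasCompactSupport.mul_right)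
  obtain ⟨B, hB, hBe⟩ := exists_contDiff_taylor_eq (fun k e => χ e * d (f k) e)
    (fun k => hχ.mul (hd _)) (fun k => χ.hasCompactSupport.mul_right)
  have hflat : IsFlat fun p : ℝ × E =>
      χ p.2 * h p - A (p.1 ^ 2, p.2) - p.1 * B (p.1 ^ 2, p.2) := by
    intro K
    obtain ⟨G, hG, hGe⟩ := hAe K
    obtain ⟨H, hH, hHe⟩ := hBe K
    have hsq : ContDiff ℝ ∞ fun p : ℝ × E => (p.1 ^ 2, p.2) := by fun_prop
    refine ⟨fun p => p.1 ^ K * (χ p.2 * (f K).1 p - G (p.1 ^ 2, p.2) - p.1 * H (p.1 ^ 2, p.2)),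
      ?_, fun ⟨t, e⟩ => ?_⟩
    · exact (contDiff_fst.pow K).mul ((((hχ.comp contDiff_snd).mul (f K).2).sub
        (hG.comp hsq)).sub (contDiff_fst.mul (hH.comp hsq)))
    · simp only [hGe, hHe, hf K t e, mul_assoc, ← Finset.mul_sum]
      ring
  obtain ⟨P, Q, hP, hQ, hPQ⟩ := hflat.exists_eq_even_add_odd
  refine ⟨fun p => A p + P p, fun p => B p + Q p, hA.add hP, hB.add hQ, ?_⟩
  filter_upwards [χ.eventuallyEq_one] with e he t
  have := hPQ t e
  simp only [he, Pi.one_apply] at this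
  linear_combination this

end BorelLemma

section Cusp

variable {E : Type*} [NormedAddCommGroup E] [NormedSpace ℝ E]

/-- A function of `t` with vanishing derivative at `0` is a combination of `1` and `t ^ 3` over
the smooth functions of `t ^ 2`. -/
lemma exists_eq_add_cube_mul [FiniteDimensional ℝ E] {h : ℝ × E → ℝ} (hh : ContDiff ℝ ∞ h)
    (h0 : ∀ e, HasDerivAt (fun t => h (t, e)) 0 0) :
    ∃ P Q : ℝ × E → ℝ, ContDiff ℝ ∞ P ∧ ContDiff ℝ ∞ Q ∧
      ∀ᶠ e in nhds (0 : E), ∀ t, h (t, e) = P (t ^ 2, e) + t ^ 3 * Q (t ^ 2, e) := by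
  obtain ⟨P, R, hP, hR, he⟩ := exists_eq_even_add_odd hh
  obtain ⟨Q, hQ, hQe⟩ := exists_contDiff_eq_add_mul hR
  refine ⟨P, Q, hP, hQ, ?_⟩
  filter_upwards [he] with e he t
  have hsq : HasDerivAt (fun t : ℝ => t ^ 2) 0 0 := by simpa using hasDerivAt_pow 2 (0 : ℝ)
  have hd (F : ℝ × E → ℝ) (hF : ContDiff ℝ ∞ F) :
      HasDerivAt (fun t : ℝ => F (t ^ 2, e)) 0 0 := by
    have := HasDerivAt.comp (0 : ℝ) (hF.hasDerivAt_fst ((0 : ℝ) ^ 2) e) hsq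
    exact this.congr_deriv (mul_zero _)
  have h1 := ((hd P hP).add ((hasDerivAt_id (0 : ℝ)).mul (hd R hR))).unique
    ((h0 e).congr_of_eventuallyEq (.of_forall fun t => (he t).symm))
  have hR0 : R (0, e) = 0 := by simpa using h1
  rw [he, hQe, hR0]
  ring

/-- A smooth function `D (v, y)` vanishing to second order along `v = 0` is divisible by `v ^ 2`
(along those parameters `y` for which the vanishing holds). -/
lemma exists_eq_sq_mul [FiniteDimensional ℝ E] {D : ℝ × E → ℝ} (hD : ContDiff ℝ ∞ D) :
    ∃ M : ℝ × E → ℝ, ContDiff ℝ ∞ M ∧ ∀ y, D (0, y) = 0 → fderiv ℝ D (0, y) (1, 0) = 0 →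
      ∀ v, D (v, y) = v ^ 2 * M (v, y) := by
  obtain ⟨G, hG, hGe⟩ := exists_contDiff_eq_add_mul hD
  obtain ⟨M, hM, hMe⟩ := exists_contDiff_eq_add_mul hG
  refine ⟨M, hM, fun y h0 h1 v => ?_⟩
  have h2 := ((hasDerivAt_id (0 : ℝ)).mul (hG.hasDerivAt_fst 0 y)).unique
    ((hD.hasDerivAt_fst 0 y).congr_of_eventuallyEq (.of_forall fun t => by
      simpa [h0] using (hGe t y).symm))
  have hG0 : G (0, y) = 0 := by simpa [h1] using h2
  rw [hGe, hMe, h0, hG0]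
  ring

/-- Division by the square of `x ^ 2 + α` modulo functions of `(x ^ 3 / 3 + α x, e)`, for a
function whose `x`-derivative is divisible by `x ^ 2 + α`. -/
lemma exists_eq_mul_sq_add_comp_cusp [FiniteDimensional ℝ E] {α : E → ℝ} (hα : ContDiff ℝ ∞ α)
    {φ a : ℝ × E → ℝ} (hφ : ContDiff ℝ ∞ φ) (ha : ContDiff ℝ ∞ a)
    (hd : ∀ᶠ p in nhds (0 : ℝ × E), fderiv ℝ φ p (1, 0) = a p * (p.1 ^ 2 + α p.2)) :
    ∃ μ η : ℝ × E → ℝ, ContDiff ℝ ∞ μ ∧ ContDiff ℝ ∞ η ∧ ∀ᶠ p in nhds (0 : ℝ × E),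
      φ p = μ p * (p.1 ^ 2 + α p.2) ^ 2 + η (p.1 ^ 3 / 3 + α p.2 * p.1, p.2) := by
  obtain ⟨b, hb, hb0, hb'⟩ := exists_contDiff_primitive ha
  obtain ⟨A, hA, hA0, hA'⟩ := exists_contDiff_primitive
    (ha.mul (contDiff_fst.pow 2) : ContDiff ℝ ∞ fun p : ℝ × E => a p * p.1 ^ 2)
  have hφe : ∀ᶠ p in nhds (0 : ℝ × E), φ p = φ (0, p.2) + A p + α p.2 * b p := by
    obtain ⟨r, hr, hball⟩ := Metric.eventually_nhds_iff_ball.1 hd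
    filter_upwards [Metric.ball_mem_nhds 0 hr] with ⟨x, e⟩ hp
    rw [mem_ball_zero_iff, Prod.norm_mk, max_lt_iff] at hp
    have hder : ∀ s ∈ Set.uIcc 0 x, HasDerivAt (fun s => φ (s, e) - A (s, e) - α e * b (s, e))
        0 s := by
      intro s hs
      have hs' : |s| ≤ |x| := by simpa using Set.abs_sub_left_of_mem_uIcc hs
      have h1 := hball (s, e) (by
        rw [mem_ball_zero_iff, Prod.norm_mk, max_lt_iff]
        exact ⟨hs'.trans_lt hp.1, hp.2⟩)
      have h2 := ((hφ.hasDerivAt_fst s e).sub (hA' s e)).sub ((hb' s e).const_mul (α e))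
      refine h2.congr_deriv ?_
      rw [h1]
      ring
    have := intervalIntegral.integral_eq_sub_of_hasDerivAt hder intervalIntegrable_const
    simp only [intervalIntegral.integral_zero, hA0, hb0] at this
    linear_combination -this
  have hφ0 : ContDiff ℝ ∞ fun p : ℝ × E => φ (0, p.2) := hφ.comp (by fun_prop)
  have hh : ∀ t e, HasDerivAt (fun t => φ (0, e) + A (t, e) - t ^ 2 * b (t, e))
      (-(2 * t * b (t, e))) t := by
    intro t e
    have := (((hasDerivAt_const t (φ (0, e))).add (hA' t e))).sub
      ((hasDerivAt_pow 2 t).mul (hb' t e))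
    refine this.congr_deriv ?_
    simp
    ring
  obtain ⟨P, Q, hP, hQ, hPQ⟩ := exists_eq_add_cube_mul
    (h := fun p => φ (0, p.2) + A p - p.1 ^ 2 * b p)
    ((hφ0.add hA).sub ((contDiff_fst.pow 2).mul hb)) (fun e => by simpa using hh 0 e)
  let D : ℝ × ℝ × E → ℝ := fun q => φ (0, q.2.2) + A q.2 + (q.1 - q.2.1 ^ 2) * b q.2
    - P (q.2.1 ^ 2 - q.1, q.2.2)
    + 3 / 2 * (q.2.1 ^ 3 / 3 + (q.1 - q.2.1 ^ 2) * q.2.1) * Q (q.2.1 ^ 2 - q.1, q.2.2)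
  have hD : ContDiff ℝ ∞ D := by
    have hsq : ContDiff ℝ ∞ fun q : ℝ × ℝ × E => (q.2.1 ^ 2 - q.1, q.2.2) := by fun_prop
    have hv : ContDiff ℝ ∞ fun q : ℝ × ℝ × E => q.1 - q.2.1 ^ 2 := by fun_prop
    have hy : ContDiff ℝ ∞ fun q : ℝ × ℝ × E =>
      3 / 2 * (q.2.1 ^ 3 / 3 + (q.1 - q.2.1 ^ 2) * q.2.1) := by fun_prop
    exact ((((hφ0.comp contDiff_snd).add (hA.comp contDiff_snd)).add
      (hv.mul (hb.comp contDiff_snd))).sub (hP.comp hsq)).add (hy.mul (hQ.comp hsq))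
  obtain ⟨M, hM, hMe⟩ := exists_eq_sq_mul hD
  refine ⟨fun p => M (p.1 ^ 2 + α p.2, p),
    fun p => P (-α p.2, p.2) - 3 / 2 * p.1 * Q (-α p.2, p.2), ?_, ?_, ?_⟩
  · exact hM.comp (((contDiff_fst.pow 2).add (hα.comp contDiff_snd)).prodMk contDiff_id)
  · have hs : ContDiff ℝ ∞ fun p : ℝ × E => (-α p.2, p.2) :=
      (hα.comp contDiff_snd).neg.prodMk contDiff_snd
    exact (hP.comp hs).sub ((contDiff_const.mul contDiff_fst).mul (hQ.comp hs))
  filter_upwards [hφe, continuous_snd.continuousAt.eventually hPQ] with ⟨x, e⟩ hx he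
  simp only at hx he
  have hD0 : ∀ x, D (0, x, e) = 0 := by
    intro x
    simp only [D, sub_zero]
    linear_combination he x
  have hD1 : ∀ x, fderiv ℝ D (0, x, e) (1, 0) = b (x, e) + fderiv ℝ P (x ^ 2, e) (1, 0)
      + 3 / 2 * x * Q (x ^ 2, e) + x ^ 3 * fderiv ℝ Q (x ^ 2, e) (1, 0) := by
    intro x
    have hs : HasDerivAt (fun v : ℝ => x ^ 2 - v) (-1) 0 := (hasDerivAt_id _).const_sub _
    have hc (F : ℝ × E → ℝ) (hF : ContDiff ℝ ∞ F) :
        HasDerivAt (fun v : ℝ => F (x ^ 2 - v, e)) (fderiv ℝ F (x ^ 2, e) (1, 0) * -1) 0 := by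
      have := HasDerivAt.comp (0 : ℝ) (hF.hasDerivAt_fst (x ^ 2 - 0) e) hs
      exact this.congr_deriv (by rw [sub_zero])
    have hl : HasDerivAt (fun v : ℝ => v - x ^ 2) 1 0 := (hasDerivAt_id _).sub_const _
    have h1 := (((hl.mul_const (b (x, e))).const_add (φ (0, e) + A (x, e))).sub (hc P hP)).add
      ((((hl.mul_const x).const_add (x ^ 3 / 3)).const_mul (3 / 2)).mul (hc Q hQ))
    refine ((hD.hasDerivAt_fst 0 (x, e)).unique h1).trans ?_
    simp only [sub_zero]
    ring
  have hmul : ∀ x, x * fderiv ℝ D (0, x, e) (1, 0) = 0 := by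
    intro x
    have hs := hasDerivAt_pow 2 x
    have hc (F : ℝ × E → ℝ) (hF : ContDiff ℝ ∞ F) := HasDerivAt.comp x
      (hF.hasDerivAt_fst (x ^ 2) e) hs
    have h1 := ((hc P hP).add ((hasDerivAt_pow 3 x).mul (hc Q hQ))).unique
      ((hh x e).congr_of_eventuallyEq (.of_forall fun t => (he t).symm))
    rw [hD1]
    simp at h1
    linear_combination h1 / 2
  have hD1c : Continuous fun x => fderiv ℝ D (0, x, e) (1, 0) :=
    (hD.fderiv_apply_const _).continuous.comp (by fun_prop)
  have hD1z : (fun x => fderiv ℝ D (0, x, e) (1, 0)) = fun _ => 0 :=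
    Continuous.ext_on (dense_compl_singleton (0 : ℝ)) hD1c continuous_const
      fun x hx => (mul_eq_zero.1 (hmul x)).resolve_left hx
  have h := hMe (x, e) (hD0 x) (congrFun hD1z x) (x ^ 2 + α e)
  simp only [D] at h
  rw [hx]
  simp only [show x ^ 2 - (x ^ 2 + α e) = -α e by ring, show x ^ 2 + α e - x ^ 2 = α e by ring] at h
  linear_combination h

end Cusp
/-- Let `g(x, λ) = (x³/3 + α(λ)x, λ)` with `α(0) = 0`. If `φ` is C∞ and
`dφ = a·dg₁ + Σⱼ bⱼ·dλⱼ` near `0` with C∞ coefficients, then near `0`,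
`φ(x,λ) = μ(x,λ)(x² + α(λ))² + η(g(x,λ))` with `μ, η` C∞. -/
theorem ramification_eq_case_cusp (n : ℕ) (hn : 2 ≤ n)
    (α : (Fin (n - 1) → ℝ) → ℝ) (hα : ContDiff ℝ ∞ α) (hα0 : α 0 = 0)
    (φ : ℝ × (Fin (n - 1) → ℝ) → ℝ) (hφ : ContDiff ℝ ∞ φ)
    (U : Set (ℝ × (Fin (n - 1) → ℝ))) (hU : U ∈ nhds (0 : ℝ × (Fin (n - 1) → ℝ)))
    (a : ℝ × (Fin (n - 1) → ℝ) → ℝ) (ha : ContDiff ℝ ∞ a)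
    (b : Fin (n - 1) → ℝ × (Fin (n - 1) → ℝ) → ℝ) (hb : ∀ j, ContDiff ℝ ∞ (b j))
    (hd : ∀ p ∈ U, ∀ v : ℝ × (Fin (n - 1) → ℝ),
      fderiv ℝ φ p v =
        a p * fderiv ℝ (fun q : ℝ × (Fin (n - 1) → ℝ) => q.1 ^ 3 / 3 + α q.2 * q.1) p v
        + ∑ j, b j p * fderiv ℝ (fun q : ℝ × (Fin (n - 1) → ℝ) => q.2 j) p v) :
    ∃ (V : Set (ℝ × (Fin (n - 1) → ℝ)))
      (μ : ℝ × (Fin (n - 1) → ℝ) → ℝ) (η : ℝ × (Fin (n - 1) → ℝ) → ℝ),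
      V ∈ nhds (0 : ℝ × (Fin (n - 1) → ℝ)) ∧ ContDiff ℝ ∞ μ ∧ ContDiff ℝ ∞ η ∧
      ∀ p ∈ V, φ p = μ p * (p.1 ^ 2 + α p.2) ^ 2 + η (p.1 ^ 3 / 3 + α p.2 * p.1, p.2) := by
  obtain ⟨μ, η, hμ, hη, he⟩ := exists_eq_mul_sq_add_comp_cusp hα hφ ha <| by
    filter_upwards [hU] with p hp
    have hg : HasFDerivAt (fun q : ℝ × (Fin (n - 1) → ℝ) => q.1 ^ 3 / 3 + α q.2 * q.1) _ p :=
      (((hasFDerivAt_fst (𝕜 := ℝ) (p := p)).pow 3).mul_const (3⁻¹ : ℝ)).add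
        (((hα.differentiable (by simp) p.2).hasFDerivAt.comp p hasFDerivAt_snd).mul
          hasFDerivAt_fst)
    have hl (j : Fin (n - 1)) : HasFDerivAt (fun q : ℝ × (Fin (n - 1) → ℝ) => q.2 j) _ p :=
      (hasFDerivAt_apply (𝕜 := ℝ) j p.2).comp p hasFDerivAt_snd
    have h := hd p hp (1, 0)
    simp only [hg.fderiv, (hl _).fderiv] at h
    rw [h]
    simp
  exact ⟨_, μ, η, he, hμ, hη, fun p hp => hp⟩
end

section
/- Let n ≥ 2 and ℓ ≥ 1, let α : ℝ^{n−1} → ℝ be a C∞ function with α(0) = 0, and define g(x, λ) = (x³/3 + α(λ)x, λ). Let ψ₁, …, ψ_ℓ : ℝⁿ → ℝ be C∞ functions with ψᵢ(0) = 0 such that for each i there exist a neighborhood of 0 and a C∞ function aᵢ with ∂ψᵢ/∂x(x,λ) = aᵢ(x,λ)·(x² + α(λ)) on it. Then there exist open neighborhoods W, W' of 0 in ℝⁿ × ℝ^ℓ, a C∞ diffeomorphism H̃ : W → W' with H̃(0) = 0, C∞ functions μ₁, …, μ_ℓ : ℝⁿ → ℝ, and a neighborhood V of 0 in ℝⁿ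 such that for all (x, λ) ∈ V, H̃(g(x,λ), ψ₁(x,λ), …, ψ_ℓ(x,λ)) = (g(x,λ), μ₁(x,λ)·(x² + α(λ))², …, μ_ℓ(x,λ)·(x² + α(λ))²). -/
open scoped ContDiff

open MeasureTheory in
/-- Differentiation under the integral sign, all orders at once: if every derivative of the smooth
function `F` on `P × V` is dominated, locally uniformly in the parameter, by an integrable
function, then the integral over `V` depends smoothly on the parameter. -/
theorem contDiff_integral_of_dominated {P V G : Type}
    [NormedAddCommGroup P] [NormedSpace ℝ P]
    [NormedAddCommGroup V] [NormedSpace ℝ V] [MeasurableSpace V] [BorelSpace V]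
    [SecondCountableTopology V] [NormedAddCommGroup G] [NormedSpace ℝ G]
    (ν : Measure V) (F : P × V → G) (hF : ContDiff ℝ ∞ F)
    (hb : ∀ (n : ℕ) (p₀ : P), ∃ bound : V → ℝ, Integrable bound ν ∧
      ∀ᵐ w ∂ν, ∀ p ∈ Metric.ball p₀ 1, ‖iteratedFDeriv ℝ n F (p, w)‖ ≤ bound w) :
    ContDiff ℝ ∞ (fun p ↦ ∫ w, F (p, w) ∂ν) := by
  rw [contDiff_infty]
  intro n
  induction n generalizing G with
  | zero =>
    refine contDiff_zero.2 (continuous_iff_continuousAt.2 fun p₀ ↦ ?_)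
    obtain ⟨bound, hint, hbd⟩ := hb 0 p₀
    refine continuousAt_of_dominated (bound := bound) ?_ ?_ hint ?_
    · exact Filter.Eventually.of_forall fun p ↦
        (hF.continuous.comp (by fun_prop : Continuous fun w : V ↦ (p, w))).aestronglyMeasurable
    · filter_upwards [Metric.ball_mem_nhds p₀ one_pos] with p hp
      filter_upwards [hbd] with w hw
      simpa using hw p hp
    · exact Filter.Eventually.of_forall fun w ↦
        (hF.continuous.comp (by fun_prop : Continuous fun p : P ↦ (p, w))).continuousAt
  | succ n ih =>
    set L : (P × V →L[ℝ] G) →L[ℝ] (P →L[ℝ] G) :=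
      (ContinuousLinearMap.compL ℝ P (P × V) G).flip (ContinuousLinearMap.inl ℝ P V) with hL
    have hdF : ContDiff ℝ ∞ (fderiv ℝ F) := hF.fderiv_right (by simp)
    have hF' : ContDiff ℝ ∞ (fun q ↦ L (fderiv ℝ F q)) := L.contDiff.comp hdF
    have hbound : ∀ (k : ℕ) (p₀ : P), ∃ bound : V → ℝ, Integrable bound ν ∧
        ∀ᵐ w ∂ν, ∀ p ∈ Metric.ball p₀ 1,
          ‖iteratedFDeriv ℝ k (fun q ↦ L (fderiv ℝ F q)) (p, w)‖ ≤ bound w := by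
      intro k p₀
      obtain ⟨bound, hint, hbd⟩ := hb (k + 1) p₀
      refine ⟨fun w ↦ ‖L‖ * bound w, hint.const_mul _, ?_⟩
      filter_upwards [hbd] with w hw p hp
      refine (L.norm_iteratedFDeriv_comp_left (N := ∞) hdF.contDiffAt
        (by exact_mod_cast le_top)).trans ?_
      rw [norm_iteratedFDeriv_fderiv]
      exact mul_le_mul_of_nonneg_left (hw p hp) (norm_nonneg _)
    have key := ih (fun q ↦ L (fderiv ℝ F q)) hF' hbound
    push_cast
    refine contDiff_succ_iff_hasFDerivAt.2 ⟨_, key, fun p₀ ↦ ?_⟩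
    obtain ⟨bound, hint, hbd⟩ := hbound 0 p₀
    obtain ⟨bound0, hint0, hbd0⟩ := hb 0 p₀
    have hm : ∀ p, AEStronglyMeasurable (fun w ↦ F (p, w)) ν := fun p ↦
      (hF.continuous.comp (by fun_prop : Continuous fun w : V ↦ (p, w))).aestronglyMeasurable
    refine hasFDerivAt_integral_of_dominated_of_fderiv_le (Metric.ball_mem_nhds p₀ one_pos)
      (bound := bound) (F := fun p w ↦ F (p, w)) (F' := fun p w ↦ L (fderiv ℝ F (p, w)))
      (Filter.Eventually.of_forall hm) ?_ ?_ ?_ hint ?_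
    · refine hint0.mono' (hm p₀) ?_
      filter_upwards [hbd0] with w hw
      simpa using hw p₀ (Metric.mem_ball_self one_pos)
    · exact (hF'.continuous.comp
        (by fun_prop : Continuous fun w : V ↦ (p₀, w))).aestronglyMeasurable
    · filter_upwards [hbd] with w hw p hp
      simpa using hw p hp
    · refine Filter.Eventually.of_forall fun w p _ ↦ ?_
      exact ((hF.differentiable (by simp)) (p, w)).hasFDerivAt.comp p
        (hasFDerivAt_prodMk_left p w)

/-- The integral over `[0, 1]` of a smooth function depends smoothly on parameters. -/
theorem ContDiff.integral_zero_one {P G : Type}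
    [NormedAddCommGroup P] [NormedSpace ℝ P] [ProperSpace P]
    [NormedAddCommGroup G] [NormedSpace ℝ G] {F : P × ℝ → G} (hF : ContDiff ℝ ∞ F) :
    ContDiff ℝ ∞ (fun p ↦ ∫ t in (0 : ℝ)..1, F (p, t)) := by
  simp_rw [intervalIntegral.integral_of_le (zero_le_one (α := ℝ))]
  refine contDiff_integral_of_dominated _ F hF fun n p₀ ↦ ?_
  obtain ⟨C, hC⟩ := ((isCompact_closedBall p₀ 1).prod
    (isCompact_Icc (a := (0 : ℝ)) (b := 1))).exists_bound_of_continuousOn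
    (hF.continuous_iteratedFDeriv (m := n) (by exact_mod_cast le_top)).continuousOn
  refine ⟨fun _ ↦ C, MeasureTheory.integrable_const _, ?_⟩
  filter_upwards [MeasureTheory.ae_restrict_mem measurableSet_Ioc] with t ht p hp
  exact hC _ ⟨Metric.ball_subset_closedBall hp, Set.Ioc_subset_Icc_self ht⟩

section SchwartzIntegral

variable {P V : Type} [NormedAddCommGroup P] [NormedSpace ℝ P]
  [NormedAddCommGroup V] [NormedSpace ℝ V] [MeasurableSpace V] [BorelSpace V]
  [FiniteDimensional ℝ V] (ν : MeasureTheory.Measure V) [ν.IsAddHaarMeasure]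

open scoped SchwartzMap

theorem SchwartzMap.exists_integrable_bound_mul (s : 𝓢(V, ℂ)) {Ψ : P × V → ℂ}
    (hΨ : Ψ.HasTemperateGrowth) (n : ℕ) (p₀ : P) :
    ∃ bound : V → ℝ, MeasureTheory.Integrable bound ν ∧ ∀ w, ∀ p ∈ Metric.ball p₀ 1,
      ‖iteratedFDeriv ℝ n (fun q : P × V ↦ s q.2 * Ψ q) (p, w)‖ ≤ bound w := by
  obtain ⟨k, C, hC, hk⟩ := hΨ.norm_iteratedFDeriv_le_uniform n
  have hs : ContDiff ℝ ∞ (fun q : P × V ↦ s q.2) := (s.smooth ⊤).comp contDiff_snd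
  set a := 2 + ‖p₀‖ with ha
  refine ⟨fun w ↦ ∑ i ∈ Finset.range (n + 1), (n.choose i : ℝ) *
    (C * 2 ^ (k - 1)) * (a ^ k * (‖w‖ ^ 0 * ‖iteratedFDeriv ℝ i s w‖) +
      ‖w‖ ^ k * ‖iteratedFDeriv ℝ i s w‖), ?_, fun w p hp ↦ ?_⟩
  · exact MeasureTheory.integrable_finsetSum _ fun i _ ↦
      (((s.integrable_pow_mul_iteratedFDeriv ν 0 i).const_mul _).add
        (s.integrable_pow_mul_iteratedFDeriv ν k i)).const_mul _
  · refine (norm_iteratedFDeriv_mul_le (N := ∞) hs hΨ.1 (p, w)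
      (by exact_mod_cast le_top)).trans (Finset.sum_le_sum fun i hi ↦ ?_)
    have h1 : ‖iteratedFDeriv ℝ i (fun q : P × V ↦ s q.2) (p, w)‖ ≤ ‖iteratedFDeriv ℝ i s w‖ := by
      have := ContinuousLinearMap.iteratedFDeriv_comp_right (ContinuousLinearMap.snd ℝ P V)
        (s.smooth ⊤) (p, w) (i := i) (by exact_mod_cast le_top)
      simp only [Function.comp_def, ContinuousLinearMap.coe_snd'] at this
      rw [this]
      refine (ContinuousMultilinearMap.norm_compContinuousLinearMap_le _ _).trans ?_
      refine mul_le_of_le_one_right (norm_nonneg _) (Finset.prod_le_one (fun _ _ ↦ norm_nonneg _)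
        fun _ _ ↦ ContinuousLinearMap.norm_snd_le ℝ P V)
    have h2 : ‖iteratedFDeriv ℝ (n - i) Ψ (p, w)‖ ≤ C * 2 ^ (k - 1) * (a ^ k + ‖w‖ ^ k) := by
      refine (hk _ (Nat.sub_le _ _) _).trans ?_
      rw [mul_assoc]
      refine mul_le_mul_of_nonneg_left ?_ hC
      refine le_trans ?_ (add_pow_le (by positivity) (norm_nonneg w) k)
      refine pow_le_pow_left₀ (by positivity) ?_ k
      have hp' : ‖p‖ ≤ ‖p₀‖ + 1 := by
        have := norm_le_norm_add_norm_sub' p p₀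
        rw [mem_ball_iff_norm] at hp
        linarith
      have := norm_nonneg w
      have := norm_nonneg p
      have h3 : ‖(p, w)‖ ≤ ‖p‖ + ‖w‖ := by
        rw [Prod.norm_def]; exact max_le (by linarith) (by linarith)
      rw [ha]; linarith
    calc _ ≤ (n.choose i : ℝ) * ‖iteratedFDeriv ℝ i s w‖ *
          (C * 2 ^ (k - 1) * (a ^ k + ‖w‖ ^ k)) := by gcongr
      _ = _ := by ring

theorem SchwartzMap.integrable_mul_of_hasTemperateGrowth (s : 𝓢(V, ℂ)) {Ψ : P × V → ℂ}
    (hΨ : Ψ.HasTemperateGrowth) (p : P) :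
    MeasureTheory.Integrable (fun w ↦ s w * Ψ (p, w)) ν := by
  obtain ⟨bound, hint, hb⟩ := s.exists_integrable_bound_mul ν hΨ 0 p
  refine hint.mono' ?_ (Filter.Eventually.of_forall fun w ↦ ?_)
  · exact (s.continuous.mul (hΨ.1.continuous.comp
      (by fun_prop : Continuous fun w : V ↦ (p, w)))).aestronglyMeasurable
  · simpa using hb w p (Metric.mem_ball_self one_pos)

theorem SchwartzMap.contDiff_integral_mul (s : 𝓢(V, ℂ)) {Ψ : P × V → ℂ}
    (hΨ : Ψ.HasTemperateGrowth) : ContDiff ℝ ∞ (fun p ↦ ∫ w, s w * Ψ (p, w) ∂ν) := by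
  refine contDiff_integral_of_dominated ν (fun q : P × V ↦ s q.2 * Ψ q)
    (((s.smooth ⊤).comp contDiff_snd).mul hΨ.1) fun n p₀ ↦ ?_
  obtain ⟨bound, hint, hb⟩ := s.exists_integrable_bound_mul ν hΨ n p₀
  exact ⟨bound, hint, Filter.Eventually.of_forall hb⟩

end SchwartzIntegral

/-- There is a smooth function `E` on the line with `E (x ^ 2) = cos x`. -/
theorem exists_contDiff_cos_sqrt : ∃ E : ℝ → ℝ, ContDiff ℝ ∞ E ∧ ∀ x, E (x ^ 2) = Real.cos x := by
  set c : ℕ → ℝ := fun n ↦ (-1) ^ n / (2 * n).factorial with hc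
  have hrad : (FormalMultilinearSeries.ofScalars ℝ c).radius = ⊤ := by
    refine FormalMultilinearSeries.ofScalars_radius_eq_top_of_tendsto ℝ c
      (Filter.Eventually.of_forall fun n ↦ by simp [hc, Nat.factorial_ne_zero]) ?_
    refine squeeze_zero (fun n ↦ by positivity) (fun n ↦ ?_)
      tendsto_one_div_add_atTop_nhds_zero_nat
    have h : ((2 * (n + 1)).factorial : ℝ) =
        (2 * n + 2) * ((2 * n + 1) * (2 * n).factorial) := by
      rw [show 2 * (n + 1) = 2 * n + 1 + 1 by ring, Nat.factorial_succ, Nat.factorial_succ]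
      push_cast; ring
    have hpos : (0 : ℝ) < (2 * n).factorial := by positivity
    simp only [hc, norm_div, norm_pow, norm_neg, norm_one, one_pow, Nat.succ_eq_add_one, h,
      norm_mul, RCLike.norm_natCast, one_div]
    rw [Real.norm_of_nonneg (by positivity), Real.norm_of_nonneg (by positivity)]
    rw [div_inv_eq_mul, ← one_div, ← one_div, div_mul_eq_mul_div, one_mul,
      div_le_div_iff₀ (by positivity) (by positivity)]
    have hn : (0 : ℝ) ≤ n := n.cast_nonneg
    nlinarith [mul_nonneg hn hpos.le, mul_nonneg (mul_nonneg hn hn) hpos.le]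
  refine ⟨FormalMultilinearSeries.ofScalarsSum c, ?_, fun x ↦ ?_⟩
  · have h := (FormalMultilinearSeries.ofScalars ℝ c).hasFPowerSeriesOnBall (by simp [hrad])
    rw [hrad] at h
    exact contDiff_iff_contDiffAt.2 fun x ↦ (h.analyticAt_of_mem (by simp)).contDiffAt
  · rw [FormalMultilinearSeries.ofScalarsSum_eq_tsum, (Real.hasSum_cos x).tsum_eq.symm]
    refine tsum_congr fun n ↦ ?_
    simp only [hc, smul_eq_mul, ← pow_mul]
    ring

theorem ContDiff.hasDerivAt_iteratedDeriv {E : ℝ → ℝ} (hE : ContDiff ℝ ∞ E) (n : ℕ) (v : ℝ) :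
    HasDerivAt (iteratedDeriv n E) (iteratedDeriv (n + 1) E v) v := by
  rw [iteratedDeriv_succ]
  exact (hE.differentiable_iteratedDeriv n (by exact_mod_cast WithTop.coe_lt_top _) v).hasDerivAt

/-- The Bessel-type differential equation satisfied by `cos ∘ √` and its derivatives. -/
theorem iteratedDeriv_recurrence_of_cos_sqrt {E : ℝ → ℝ} (hE : ContDiff ℝ ∞ E)
    (hcos : ∀ x, E (x ^ 2) = Real.cos x) (n : ℕ) {v : ℝ} (hv : 0 < v) :
    4 * v * iteratedDeriv (n + 2) E v + (4 * n + 2) * iteratedDeriv (n + 1) E v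
      + iteratedDeriv n E v = 0 := by
  induction n generalizing v with
  | zero =>
    have hsq : ∀ x : ℝ, HasDerivAt (fun x : ℝ ↦ x ^ 2) (2 * x) x := fun x ↦ by
      simpa using hasDerivAt_pow 2 x
    have h1 : ∀ x : ℝ, iteratedDeriv 1 E (x ^ 2) * (2 * x) = -Real.sin x := fun x ↦ by
      have h := (hE.hasDerivAt_iteratedDeriv 0 (x ^ 2)).comp x (hsq x)
      simp only [iteratedDeriv_zero, Function.comp_def, hcos] at h
      exact h.unique (Real.hasDerivAt_cos x)
    set x := √v with hx
    have hxv : x ^ 2 = v := Real.sq_sqrt hv.le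
    have h := ((hE.hasDerivAt_iteratedDeriv 1 (x ^ 2)).comp x (hsq x)).mul
      ((hasDerivAt_id x).const_mul 2)
    have h2 := h.unique ((Real.hasDerivAt_sin x).neg.congr_of_eventuallyEq
      (Filter.Eventually.of_forall fun y ↦ h1 y))
    simp only [Function.comp_apply, id, hxv] at h2
    have h3 := hcos x
    rw [hxv] at h3
    simp only [iteratedDeriv_zero, Nat.cast_zero, h3]
    rw [← hxv] at h2 ⊢
    linear_combination h2
  | succ n ih =>
    have h := (((hasDerivAt_id v).const_mul 4).mul (hE.hasDerivAt_iteratedDeriv (n + 2) v)).add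
      (((hE.hasDerivAt_iteratedDeriv (n + 1) v).const_mul (4 * (n : ℝ) + 2))) |>.add
      (hE.hasDerivAt_iteratedDeriv n v)
    have h0 := h.unique ((hasDerivAt_const v (0 : ℝ)).congr_of_eventuallyEq
      (by filter_upwards [lt_mem_nhds hv] with y hy using ih hy))
    simp only [id] at h0
    push_cast
    linear_combination h0

theorem exists_bound_iteratedDeriv_of_cos_sqrt {E : ℝ → ℝ} (hE : ContDiff ℝ ∞ E)
    (hcos : ∀ x, E (x ^ 2) = Real.cos x) (n : ℕ) :
    ∃ K, ∀ v, 1 ≤ v → |iteratedDeriv n E v| ≤ K := by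
  induction n using Nat.strong_induction_on with
  | _ n ih =>
    match n, ih with
    | 0, _ =>
      refine ⟨1, fun v hv ↦ ?_⟩
      rw [iteratedDeriv_zero, ← Real.sq_sqrt (zero_le_one.trans hv), hcos]
      exact Real.abs_cos_le_one _
    | 1, _ =>
      refine ⟨1, fun v hv ↦ ?_⟩
      have hx1 : 1 ≤ √v := Real.one_le_sqrt.2 hv
      have h := (hE.hasDerivAt_iteratedDeriv 0 (√v ^ 2)).comp √v
        (by simpa using hasDerivAt_pow 2 √v : HasDerivAt (fun x : ℝ ↦ x ^ 2) (2 * √v) √v)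
      simp only [iteratedDeriv_zero, Function.comp_def, hcos] at h
      have h1 := h.unique (Real.hasDerivAt_cos √v)
      rw [Real.sq_sqrt (zero_le_one.trans hv)] at h1
      have h2 : |iteratedDeriv (0 + 1) E v| * (2 * √v) ≤ 1 := by
        rw [← abs_of_nonneg (by positivity : 0 ≤ 2 * √v), ← abs_mul, h1, abs_neg]
        exact Real.abs_sin_le_one _
      simp only [zero_add] at h2
      nlinarith [abs_nonneg (iteratedDeriv 1 E v)]
    | n + 2, ih =>
      obtain ⟨K₁, h₁⟩ := ih (n + 1) (by omega)
      obtain ⟨K₀, h₀⟩ := ih n (by omega)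
      refine ⟨(4 * n + 2) * K₁ + K₀, fun v hv ↦ ?_⟩
      have hrec := iteratedDeriv_recurrence_of_cos_sqrt hE hcos n (zero_lt_one.trans_le hv)
      have h3 : |4 * v * iteratedDeriv (n + 2) E v| ≤ (4 * n + 2) * K₁ + K₀ := by
        have : 4 * v * iteratedDeriv (n + 2) E v =
            -((4 * n + 2) * iteratedDeriv (n + 1) E v + iteratedDeriv n E v) := by linarith
        rw [this, abs_neg]
        refine (abs_add_le _ _).trans (add_le_add ?_ (h₀ v hv))
        rw [abs_mul, abs_of_nonneg (by positivity : (0 : ℝ) ≤ 4 * n + 2)]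
        exact mul_le_mul_of_nonneg_left (h₁ v hv) (by positivity)
      rw [abs_mul, abs_of_nonneg (by linarith : 0 ≤ 4 * v)] at h3
      nlinarith [abs_nonneg (iteratedDeriv (n + 2) E v)]

/-- A smooth function on the line with bounded derivatives which equals `cos ∘ √` on
`[0, ∞)`. -/
theorem exists_hasTemperateGrowth_cos_sqrt :
    ∃ C : ℝ → ℝ, C.HasTemperateGrowth ∧ ∀ x, C (x ^ 2) = Real.cos x := by
  obtain ⟨E, hE, hcos⟩ := exists_contDiff_cos_sqrt
  set C : ℝ → ℝ := fun v ↦ Real.smoothTransition (v + 1) * E v with hC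
  have hCs : ContDiff ℝ ∞ C :=
    (Real.smoothTransition.contDiff.comp (contDiff_id.add contDiff_const)).mul hE
  refine ⟨C, ⟨hCs, fun n ↦ ?_⟩, fun x ↦ ?_⟩
  · obtain ⟨K₁, h₁⟩ := exists_bound_iteratedDeriv_of_cos_sqrt hE hcos n
    obtain ⟨K₂, h₂⟩ := (isCompact_Icc (a := (-1 : ℝ)) (b := 1)).exists_bound_of_continuousOn
      (hCs.continuous_iteratedDeriv n (by exact_mod_cast le_top)).continuousOn
    refine ⟨0, max K₁ K₂, fun v ↦ ?_⟩
    rw [pow_zero, mul_one, norm_iteratedFDeriv_eq_norm_iteratedDeriv]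
    rcases lt_or_ge v (-1) with hv | hv
    · have : C =ᶠ[nhds v] fun _ ↦ 0 := by
        filter_upwards [gt_mem_nhds hv] with y hy
        simp [hC, Real.smoothTransition.zero_of_nonpos (by linarith : y + 1 ≤ 0)]
      rw [this.iteratedDeriv_eq]
      have := (norm_nonneg _).trans (h₂ 0 (by simp))
      simp [this]
    rcases le_or_gt v 1 with hv1 | hv1
    · exact (h₂ v ⟨hv, hv1⟩).trans (le_max_right _ _)
    · have : C =ᶠ[nhds v] E := by
        filter_upwards [lt_mem_nhds hv1] with y hy
        simp [hC, Real.smoothTransition.one_of_one_le (by linarith : 1 ≤ y + 1)]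
      rw [this.iteratedDeriv_eq]
      exact (h₁ v hv1.le).trans (le_max_left _ _)
  · simp only [hC, hcos]
    rw [Real.smoothTransition.one_of_one_le (by nlinarith [sq_nonneg x]), one_mul]

theorem Function.HasTemperateGrowth.deriv {C : ℝ → ℝ} (hC : C.HasTemperateGrowth) :
    (_root_.deriv C).HasTemperateGrowth := by
  refine ⟨?_, fun n ↦ ?_⟩
  · exact (contDiff_infty_iff_deriv.1 hC.1).2
  · obtain ⟨k, K, h⟩ := hC.2 (n + 1)
    refine ⟨k, K, fun x ↦ ?_⟩
    simpa only [norm_iteratedFDeriv_eq_norm_iteratedDeriv, iteratedDeriv_succ'] using h x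

theorem hasTemperateGrowth_cos : Real.cos.HasTemperateGrowth :=
  ⟨Real.contDiff_cos, fun n ↦ ⟨0, 1, fun x ↦ by
    simpa [norm_iteratedFDeriv_eq_norm_iteratedDeriv] using Real.abs_iteratedDeriv_cos_le_one n x⟩⟩

theorem hasTemperateGrowth_sin : Real.sin.HasTemperateGrowth :=
  ⟨Real.contDiff_sin, fun n ↦ ⟨0, 1, fun x ↦ by
    simpa [norm_iteratedFDeriv_eq_norm_iteratedDeriv] using Real.abs_iteratedDeriv_sin_le_one n x⟩⟩

section Fold

open scoped SchwartzMap FourierTransform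

/-- The even and odd parts of a plane wave in the variable `x`, written as functions of `x ^ 2`
that are defined, smooth and of temperate growth for all real values of that argument. -/
theorem exists_hasTemperateGrowth_planeWave (m : ℕ) :
    ∃ ΨA ΨB : (ℝ × (Fin m → ℝ)) × EuclideanSpace ℝ (Fin (m + 1)) → ℂ,
      ΨA.HasTemperateGrowth ∧ ΨB.HasTemperateGrowth ∧
      ∀ (x : ℝ) (y : Fin m → ℝ) (w : EuclideanSpace ℝ (Fin (m + 1))),
        Complex.exp (((2 * Real.pi * (w 0 * x + ∑ i, w i.succ * y i) : ℝ) : ℂ) * Complex.I) =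
          ΨA ((x ^ 2, y), w) + x * ΨB ((x ^ 2, y), w) := by
  obtain ⟨C, hC, hcos⟩ := exists_hasTemperateGrowth_cos_sqrt
  have hsin : ∀ x, x * (-2 * deriv C (x ^ 2)) = Real.sin x := fun x ↦ by
    have h := ((hC.1.differentiable (by simp)) (x ^ 2)).hasDerivAt.comp x
      (by simpa using hasDerivAt_pow 2 x : HasDerivAt (fun x : ℝ ↦ x ^ 2) (2 * x) x)
    simp only [Function.comp_def, hcos] at h
    linear_combination -(h.unique (Real.hasDerivAt_cos x))
  set Q := (ℝ × (Fin m → ℝ)) × EuclideanSpace ℝ (Fin (m + 1))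
  have hu : (fun q : Q ↦ q.1.1).HasTemperateGrowth :=
    ((ContinuousLinearMap.fst ℝ ℝ (Fin m → ℝ)).comp
      (ContinuousLinearMap.fst ℝ (ℝ × (Fin m → ℝ))
        (EuclideanSpace ℝ (Fin (m + 1))))).hasTemperateGrowth
  have hy : ∀ i, (fun q : Q ↦ q.1.2 i).HasTemperateGrowth := fun i ↦
    (((ContinuousLinearMap.proj i).comp (ContinuousLinearMap.snd ℝ ℝ (Fin m → ℝ))).comp
      (ContinuousLinearMap.fst ℝ (ℝ × (Fin m → ℝ))
        (EuclideanSpace ℝ (Fin (m + 1))))).hasTemperateGrowth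
  have hw : ∀ j, (fun q : Q ↦ q.2 j).HasTemperateGrowth := fun j ↦
    ((EuclideanSpace.proj (𝕜 := ℝ) j).comp (ContinuousLinearMap.snd ℝ (ℝ × (Fin m → ℝ))
      (EuclideanSpace ℝ (Fin (m + 1))))).hasTemperateGrowth
  set θ : Q → ℝ := fun q ↦ 2 * Real.pi * q.2 0
  set φ : Q → ℝ := fun q ↦ 2 * Real.pi * ∑ i, q.2 i.succ * q.1.2 i
  have hθ : θ.HasTemperateGrowth := (Function.HasTemperateGrowth.const _).fun_mul (hw 0)
  have hφ : φ.HasTemperateGrowth := (Function.HasTemperateGrowth.const _).fun_mul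
    (Function.HasTemperateGrowth.sum fun i _ ↦ (hw i.succ).fun_mul (hy i))
  have hof : ∀ {f : Q → ℝ}, f.HasTemperateGrowth →
      (fun q ↦ (f q : ℂ)).HasTemperateGrowth := fun hf ↦
    Function.Complex.hasTemperateGrowth_ofReal.comp hf
  have he : (fun q ↦ (Real.cos (φ q) : ℂ) + Real.sin (φ q) * Complex.I).HasTemperateGrowth :=
    (hof (hasTemperateGrowth_cos.comp hφ)).fun_add
      ((hof (hasTemperateGrowth_sin.comp hφ)).fun_mul (Function.HasTemperateGrowth.const _))
  have harg : (fun q : Q ↦ θ q ^ 2 * q.1.1).HasTemperateGrowth := (hθ.fun_pow 2).fun_mul hu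
  refine ⟨fun q ↦ (C (θ q ^ 2 * q.1.1) : ℂ) *
      ((Real.cos (φ q) : ℂ) + Real.sin (φ q) * Complex.I),
    fun q ↦ ((θ q * (-2 * deriv C (θ q ^ 2 * q.1.1)) : ℝ) : ℂ) * Complex.I *
      ((Real.cos (φ q) : ℂ) + Real.sin (φ q) * Complex.I),
    (hof (hC.comp harg)).fun_mul he,
    ((hof (hθ.fun_mul ((Function.HasTemperateGrowth.const _).fun_mul
      (hC.deriv.comp harg)))).fun_mul (Function.HasTemperateGrowth.const _)).fun_mul he,
    fun x y w ↦ ?_⟩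
  set t : ℝ := 2 * Real.pi * w 0
  set s : ℝ := 2 * Real.pi * ∑ i, w i.succ * y i
  have h1 : 2 * Real.pi * (w 0 * x + ∑ i, w i.succ * y i) = t * x + s := by ring
  have h2 : t ^ 2 * x ^ 2 = (t * x) ^ 2 := by ring
  have h3 : x * (t * (-2 * deriv C ((t * x) ^ 2))) = Real.sin (t * x) := by
    rw [← hsin (t * x)]; ring
  change _ = (C (t ^ 2 * x ^ 2) : ℂ) * ((Real.cos s : ℂ) + Real.sin s * Complex.I) +
    x * (((t * (-2 * deriv C (t ^ 2 * x ^ 2)) : ℝ) : ℂ) * Complex.I *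
      ((Real.cos s : ℂ) + Real.sin s * Complex.I))
  rw [h1, h2, hcos, ← mul_assoc, ← mul_assoc, ← Complex.ofReal_mul x, h3, Complex.ofReal_add,
    add_mul, Complex.exp_add, Complex.exp_mul_I, Complex.exp_mul_I]
  push_cast
  ring

/-- Malgrange preparation for the fold: near the origin every smooth function of `(x, y)` is
`A (x ^ 2, y) + x * B (x ^ 2, y)` with `A` and `B` smooth. -/
theorem ContDiff.exists_fold_decomposition {m : ℕ} {f : ℝ × (Fin m → ℝ) → ℝ}
    (hf : ContDiff ℝ ∞ f) :
    ∃ A B : ℝ × (Fin m → ℝ) → ℝ, ContDiff ℝ ∞ A ∧ ContDiff ℝ ∞ B ∧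
      ∀ᶠ p in nhds (0 : ℝ × (Fin m → ℝ)), f p = A (p.1 ^ 2, p.2) + p.1 * B (p.1 ^ 2, p.2) := by
  set e : EuclideanSpace ℝ (Fin (m + 1)) → ℝ × (Fin m → ℝ) := fun v ↦ (v 0, fun i ↦ v i.succ)
  set j : ℝ × (Fin m → ℝ) → EuclideanSpace ℝ (Fin (m + 1)) := fun p ↦
    WithLp.toLp 2 (Fin.cons p.1 p.2)
  have he : ContDiff ℝ ∞ e := by fun_prop
  have hej : ∀ p, e (j p) = p := fun p ↦ by simp [e, j]
  have hj : Continuous j := by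
    refine (PiLp.continuous_toLp 2 _).comp (continuous_pi fun i ↦ ?_)
    refine Fin.cases ?_ (fun i ↦ ?_) i
    · simpa using continuous_fst
    · simp only [Fin.cons_succ]
      exact (continuous_apply i).comp continuous_snd
  have hj0 : j 0 = 0 := by
    ext i
    refine Fin.cases ?_ (fun i ↦ ?_) i <;> simp [j]
  let χ : ContDiffBump (0 : EuclideanSpace ℝ (Fin (m + 1))) := ⟨1, 2, one_pos, one_lt_two⟩
  have hsmooth : ContDiff ℝ ∞ (fun v ↦ ((χ v * f (e v) : ℝ) : ℂ)) :=
    Complex.ofRealCLM.contDiff.comp (χ.contDiff.mul (hf.comp he))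
  have hsupp : HasCompactSupport (fun v ↦ ((χ v * f (e v) : ℝ) : ℂ)) :=
    (χ.hasCompactSupport.mul_right (f' := fun v ↦ f (e v))).comp_left
      (g := fun r : ℝ ↦ (r : ℂ)) (by simp)
  set g : 𝓢(EuclideanSpace ℝ (Fin (m + 1)), ℂ) := hsupp.toSchwartzMap hsmooth
  obtain ⟨ΨA, ΨB, hA, hB, hΨ⟩ := exists_hasTemperateGrowth_planeWave m
  refine ⟨fun p ↦ (∫ w, (𝓕 g) w * ΨA (p, w)).re, fun p ↦ (∫ w, (𝓕 g) w * ΨB (p, w)).re,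
    Complex.reCLM.contDiff.comp ((𝓕 g).contDiff_integral_mul MeasureTheory.volume hA),
    Complex.reCLM.contDiff.comp ((𝓕 g).contDiff_integral_mul MeasureTheory.volume hB), ?_⟩
  have hnear : ∀ᶠ p in nhds (0 : ℝ × (Fin m → ℝ)), χ (j p) = 1 := by
    have := hj.tendsto 0
    rw [hj0] at this
    exact this.eventually χ.eventuallyEq_one
  filter_upwards [hnear] with p hp
  have hinv : g (j p) = ∫ w, (𝓕 g) w *
      (ΨA ((p.1 ^ 2, p.2), w) + p.1 * ΨB ((p.1 ^ 2, p.2), w)) := by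
    have h1 : g (j p) = (𝓕⁻ (𝓕 g)) (j p) := by simp
    rw [h1, SchwartzMap.fourierInv_coe, Real.fourierInv_eq']
    refine MeasureTheory.integral_congr_ae (Filter.Eventually.of_forall fun w ↦ ?_)
    have hin : Inner.inner ℝ w (j p) = w 0 * p.1 + ∑ i, w i.succ * p.2 i := by
      simp [PiLp.inner_apply, Fin.sum_univ_succ, j, mul_comm]
    simp only [hin, hΨ, smul_eq_mul]
    exact mul_comm _ _
  have hg : g (j p) = (f p : ℂ) := by
    change ((χ (j p) * f (e (j p)) : ℝ) : ℂ) = _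
    rw [hp, hej, one_mul]
  have hIA := (𝓕 g).integrable_mul_of_hasTemperateGrowth MeasureTheory.volume hA (p.1 ^ 2, p.2)
  have hIB := (𝓕 g).integrable_mul_of_hasTemperateGrowth MeasureTheory.volume hB (p.1 ^ 2, p.2)
  have hsplit : ∫ w, (𝓕 g) w * (ΨA ((p.1 ^ 2, p.2), w) + p.1 * ΨB ((p.1 ^ 2, p.2), w)) =
      (∫ w, (𝓕 g) w * ΨA ((p.1 ^ 2, p.2), w)) +
        p.1 * ∫ w, (𝓕 g) w * ΨB ((p.1 ^ 2, p.2), w) := by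
    rw [← MeasureTheory.integral_const_mul, ← MeasureTheory.integral_add hIA (hIB.const_mul _)]
    congr 1
    ext w
    ring
  have h := congrArg Complex.re (hg.symm.trans (hinv.trans hsplit))
  simpa using h

end Fold

section OneVariable

variable {E : Type} [NormedAddCommGroup E] [NormedSpace ℝ E]

theorem ContDiff.hasDerivAt_partial_fst {M : ℝ × E → ℝ} (hM : ContDiff ℝ ∞ M) (u : ℝ) (y : E) :
    HasDerivAt (fun u ↦ M (u, y)) (fderiv ℝ M (u, y) (1, 0)) u :=
  ((hM.differentiable (by simp)) (u, y)).hasFDerivAt.comp_hasDerivAt u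
    ((hasDerivAt_id u).prodMk (hasDerivAt_const u y))

variable [FiniteDimensional ℝ E]

/-- Hadamard's lemma along the graph of a function `v`. -/
theorem ContDiff.exists_sub_eq_mul {M : ℝ × E → ℝ} (hM : ContDiff ℝ ∞ M) {v : E → ℝ}
    (hv : ContDiff ℝ ∞ v) :
    ∃ R : ℝ × E → ℝ, ContDiff ℝ ∞ R ∧
      (∀ u y, M (u, y) = M (v y, y) + (u - v y) * R (u, y)) ∧
      ∀ y, R (v y, y) = fderiv ℝ M (v y, y) (1, 0) := by
  have hdM : ContDiff ℝ ∞ (fun q ↦ fderiv ℝ M q (1, 0)) :=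
    (hM.fderiv_right (by simp)).clm_apply contDiff_const
  have hF : ContDiff ℝ ∞ (fun q : (ℝ × E) × ℝ ↦
      fderiv ℝ M (v q.1.2 + q.2 * (q.1.1 - v q.1.2), q.1.2) (1, 0)) :=
    hdM.comp (f := fun q : (ℝ × E) × ℝ ↦ (v q.1.2 + q.2 * (q.1.1 - v q.1.2), q.1.2))
      (by fun_prop)
  have : ProperSpace (ℝ × E) := FiniteDimensional.proper_real _
  refine ⟨_, hF.integral_zero_one, fun u y ↦ ?_, fun y ↦ by simp⟩
  have hd : ∀ t ∈ Set.uIcc (0 : ℝ) 1, HasDerivAt (fun t ↦ M (v y + t * (u - v y), y))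
      (fderiv ℝ M (v y + t * (u - v y), y) (1, 0) * (u - v y)) t := fun t _ ↦
    (hM.hasDerivAt_partial_fst _ y).comp t
      (by simpa using ((hasDerivAt_id t).mul_const (u - v y)).const_add (v y))
  have hcont : Continuous fun t : ℝ ↦
      fderiv ℝ M (v y + t * (u - v y), y) (1, 0) * (u - v y) :=
    (hdM.continuous.comp (f := fun t : ℝ ↦ (v y + t * (u - v y), y)) (by fun_prop)).mul
      continuous_const
  have h := intervalIntegral.integral_eq_sub_of_hasDerivAt hd (hcont.intervalIntegrable 0 1)
  rw [intervalIntegral.integral_mul_const] at h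
  simp only [one_mul, zero_mul, add_zero, add_sub_cancel] at h
  linear_combination -h

/-- Second-order Taylor expansion along the graph of a function `v`. -/
theorem ContDiff.exists_taylor_two {M : ℝ × E → ℝ} (hM : ContDiff ℝ ∞ M) {v : E → ℝ}
    (hv : ContDiff ℝ ∞ v) :
    ∃ R : ℝ × E → ℝ, ContDiff ℝ ∞ R ∧ ∀ u y, M (u, y) = M (v y, y) +
      (u - v y) * fderiv ℝ M (v y, y) (1, 0) + (u - v y) ^ 2 * R (u, y) := by
  obtain ⟨R₁, hR₁, h₁, h₁'⟩ := hM.exists_sub_eq_mul hv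
  obtain ⟨R₂, hR₂, h₂, -⟩ := hR₁.exists_sub_eq_mul hv
  refine ⟨R₂, hR₂, fun u y ↦ ?_⟩
  rw [h₁ u y, h₂ u y, h₁' y]
  ring

/-- Smooth primitives with respect to the first variable. -/
theorem ContDiff.exists_primitive_fst {h : ℝ × E → ℝ} (hh : ContDiff ℝ ∞ h) :
    ∃ K : ℝ × E → ℝ, ContDiff ℝ ∞ K ∧ ∀ u y, fderiv ℝ K (u, y) (1, 0) = h (u, y) := by
  have : ProperSpace (ℝ × E) := FiniteDimensional.proper_real _
  have hF : ContDiff ℝ ∞ (fun q : (ℝ × E) × ℝ ↦ h (q.1.1 * q.2, q.1.2)) :=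
    hh.comp (f := fun q : (ℝ × E) × ℝ ↦ (q.1.1 * q.2, q.1.2)) (by fun_prop)
  have hK : ContDiff ℝ ∞ (fun p : ℝ × E ↦ p.1 * ∫ t in (0 : ℝ)..1, h (p.1 * t, p.2)) :=
    contDiff_fst.mul hF.integral_zero_one
  refine ⟨_, hK, fun u y ↦ (hK.hasDerivAt_partial_fst u y).unique ?_⟩
  have hc : Continuous fun s ↦ h (s, y) := hh.continuous.comp (by fun_prop)
  have heq : (fun u : ℝ ↦ u * ∫ t in (0 : ℝ)..1, h (u * t, y)) =
      fun u ↦ ∫ s in (0 : ℝ)..u, h (s, y) := by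
    ext u
    simpa using intervalIntegral.mul_integral_comp_mul_left (f := fun s ↦ h (s, y)) (a := 0)
      (b := 1) u
  simp only [heq]
  exact intervalIntegral.integral_hasDerivAt_right (hc.intervalIntegrable _ _)
    (hc.stronglyMeasurableAtFilter _ _) hc.continuousAt

/-- The singular equation `M + 2 u ∂M/∂u = h` has a smooth solution. -/
theorem ContDiff.exists_add_two_mul_deriv_eq {h : ℝ × E → ℝ} (hh : ContDiff ℝ ∞ h) :
    ∃ M : ℝ × E → ℝ, ContDiff ℝ ∞ M ∧
      ∀ u y, M (u, y) + 2 * u * fderiv ℝ M (u, y) (1, 0) = h (u, y) := by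
  have : ProperSpace (ℝ × E) := FiniteDimensional.proper_real _
  have hF : ContDiff ℝ ∞ (fun q : (ℝ × E) × ℝ ↦ h (q.1.1 * q.2 ^ 2, q.1.2)) :=
    hh.comp (f := fun q : (ℝ × E) × ℝ ↦ (q.1.1 * q.2 ^ 2, q.1.2)) (by fun_prop)
  have hM := hF.integral_zero_one
  refine ⟨_, hM, fun u y ↦ ?_⟩
  rcases eq_or_ne u 0 with rfl | hu
  · simp
  obtain ⟨ε, r, hr, rfl⟩ : ∃ ε r : ℝ, r ≠ 0 ∧ ε * r ^ 2 = u :=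
    ⟨SignType.sign u, √|u|, by positivity, by
      rw [Real.sq_sqrt (abs_nonneg _), sign_mul_abs]⟩
  have hc : Continuous fun s : ℝ ↦ h (ε * s ^ 2, y) :=
    hh.continuous.comp (f := fun s : ℝ ↦ (ε * s ^ 2, y)) (by fun_prop)
  have heq : (fun r : ℝ ↦ r * ∫ t in (0 : ℝ)..1, h (ε * r ^ 2 * t ^ 2, y)) =
      fun r ↦ ∫ s in (0 : ℝ)..r, h (ε * s ^ 2, y) := by
    ext r
    have hr := intervalIntegral.mul_integral_comp_mul_left (f := fun s ↦ h (ε * s ^ 2, y)) (a := 0)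
      (b := 1) r
    simp only [mul_pow, ← mul_assoc, mul_zero, mul_one] at hr
    exact hr
  have h1 : HasDerivAt (fun r : ℝ ↦ r * ∫ t in (0 : ℝ)..1, h (ε * r ^ 2 * t ^ 2, y))
      (h (ε * r ^ 2, y)) r := by
    rw [heq]
    exact intervalIntegral.integral_hasDerivAt_right (hc.intervalIntegrable _ _)
      (hc.stronglyMeasurableAtFilter _ _) hc.continuousAt
  have h2 := (hasDerivAt_id r).mul ((hM.hasDerivAt_partial_fst (ε * r ^ 2) y).comp r
    (by simpa using (hasDerivAt_pow 2 r).const_mul ε :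
      HasDerivAt (fun r : ℝ ↦ ε * r ^ 2) (ε * (2 * r)) r))
  have h3 := h2.unique h1
  simp only [Function.comp_apply, id] at h3
  rw [← h3]
  ring

end OneVariable

/-- A function whose `x`-derivative is near `0` a multiple of the Jacobian `x ^ 2 + α y` of the
unfolded cusp map is, modulo the square of the Jacobian, a smooth function of that map. -/
theorem exists_eq_comp_cusp_add_mul_sq {m : ℕ} {α : (Fin m → ℝ) → ℝ} (hα : ContDiff ℝ ∞ α)
    (hα0 : α 0 = 0) {ψ a : ℝ × (Fin m → ℝ) → ℝ} (hψ : ContDiff ℝ ∞ ψ) (hψ0 : ψ 0 = 0)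
    (ha : ContDiff ℝ ∞ a)
    (hψa : ∀ᶠ p in nhds (0 : ℝ × (Fin m → ℝ)),
      fderiv ℝ ψ p (1, 0) = a p * (p.1 ^ 2 + α p.2)) :
    ∃ F μ : ℝ × (Fin m → ℝ) → ℝ, ContDiff ℝ ∞ F ∧ ContDiff ℝ ∞ μ ∧ F 0 = 0 ∧
      ∀ᶠ p in nhds (0 : ℝ × (Fin m → ℝ)),
        ψ p = F (p.1 ^ 3 / 3 + α p.2 * p.1, p.2) + μ p * (p.1 ^ 2 + α p.2) ^ 2 := by
  obtain ⟨A, B, hA, hB, hAB⟩ := ha.exists_fold_decomposition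
  have hJ : ContDiff ℝ ∞ (fun p : ℝ × (Fin m → ℝ) ↦ p.1 + α p.2) :=
    contDiff_fst.add (hα.comp contDiff_snd)
  obtain ⟨M, hM, hM'⟩ := (hA.mul hJ).exists_add_two_mul_deriv_eq
  obtain ⟨K, hK, hK'⟩ := ((hB.mul hJ).div_const 2).exists_primitive_fst
  obtain ⟨RM, hRM, hMt⟩ := hM.exists_taylor_two hα.neg
  obtain ⟨RK, hRK, hKt⟩ := hK.exists_taylor_two hα.neg
  have hnα : ContDiff ℝ ∞ (fun y ↦ (-α y, y)) := hα.neg.prodMk contDiff_id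
  have h0 : ContDiff ℝ ∞ (fun y : Fin m → ℝ ↦ ((0 : ℝ), y)) := contDiff_const.prodMk contDiff_id
  set c : (Fin m → ℝ) → ℝ := fun y ↦ fderiv ℝ M (-α y, y) (1, 0)
  have hc : ContDiff ℝ ∞ c :=
    ((hM.fderiv_right (by simp)).clm_apply contDiff_const).comp hnα
  set d : (Fin m → ℝ) → ℝ := fun y ↦ ψ (0, y) - K (0, y) + K (-α y, y)
  have hd : ContDiff ℝ ∞ d := ((hψ.comp h0).sub (hK.comp h0)).add (hK.comp hnα)
  set F : ℝ × (Fin m → ℝ) → ℝ := fun p ↦ d p.2 + 3 * p.1 * c p.2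
  set μ : ℝ × (Fin m → ℝ) → ℝ := fun p ↦ RK (p.1 ^ 2, p.2) + p.1 * RM (p.1 ^ 2, p.2)
  have hsq : ContDiff ℝ ∞ (fun p : ℝ × (Fin m → ℝ) ↦ (p.1 ^ 2, p.2)) := by fun_prop
  have key : ∀ᶠ p in nhds (0 : ℝ × (Fin m → ℝ)),
      ψ p = F (p.1 ^ 3 / 3 + α p.2 * p.1, p.2) + μ p * (p.1 ^ 2 + α p.2) ^ 2 := by
    obtain ⟨δ, hδ, hball⟩ := Metric.eventually_nhds_iff_ball.1 (hψa.and hAB)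
    filter_upwards [Metric.ball_mem_nhds _ hδ] with ⟨x, y⟩ hp
    rw [← Prod.mk_zero_zero, ← ball_prod_same, Set.mem_prod] at hp
    have hderiv : ∀ s : ℝ, HasDerivAt
        (fun s : ℝ ↦ ψ (0, y) - K (0, y) + K (s ^ 2, y) + s * M (s ^ 2, y))
        ((A (s ^ 2, y) + s * B (s ^ 2, y)) * (s ^ 2 + α y)) s := fun s ↦ by
      have hs : HasDerivAt (fun s : ℝ ↦ s ^ 2) (2 * s) s := by simpa using hasDerivAt_pow 2 s
      have h := (((hK.hasDerivAt_partial_fst (s ^ 2) y).comp s hs).const_add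
        (ψ (0, y) - K (0, y))).add
          ((hasDerivAt_id s).mul ((hM.hasDerivAt_partial_fst (s ^ 2) y).comp s hs))
      refine h.congr_deriv ?_
      have e1 := hM' (s ^ 2) y
      have e2 := hK' (s ^ 2) y
      simp only [Function.comp_apply, id]
      rw [e2]
      linear_combination e1
    have hEq : Set.EqOn (fun s ↦ ψ (s, y))
        (fun s : ℝ ↦ ψ (0, y) - K (0, y) + K (s ^ 2, y) + s * M (s ^ 2, y))
        (Metric.ball 0 δ) := by
      refine Metric.isOpen_ball.eqOn_of_deriv_eq (convex_ball 0 δ).isPreconnected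
        (fun s _ ↦ (hψ.hasDerivAt_partial_fst s y).differentiableAt.differentiableWithinAt)
        (fun s _ ↦ (hderiv s).differentiableAt.differentiableWithinAt) (fun s hs ↦ ?_)
        (Metric.mem_ball_self hδ) (by simp)
      obtain ⟨e1, e2⟩ := hball (s, y) (by
        rw [← Prod.mk_zero_zero, ← ball_prod_same]; exact ⟨hs, hp.2⟩)
      rw [(hψ.hasDerivAt_partial_fst s y).deriv, (hderiv s).deriv, e1, e2]
    have hx := hEq hp.1
    have e1 := hMt (x ^ 2) y
    have e2 := hKt (x ^ 2) y
    have e3 := hM' (-α y) y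
    have e4 := hK' (-α y) y
    simp only [neg_add_cancel, mul_zero, zero_div] at e1 e2 e3 e4
    rw [e4] at e2
    simp only [F, μ, d, c] at hx ⊢
    rw [hx, e1, e2]
    linear_combination x * e3
  refine ⟨F, μ, ?_, ?_, ?_, key⟩
  · exact (hd.comp contDiff_snd).add ((contDiff_const.mul contDiff_fst).mul (hc.comp contDiff_snd))
  · exact (hRK.comp hsq).add (contDiff_fst.mul (hRM.comp hsq))
  · change F (0, 0) = 0
    simpa [hα0, hψ0] using key.self_of_nhds.symm

/-- For `g(x,λ) = (x³/3 + α(λ)x, λ)` with `α(0)=0`, any opening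
`(g, ψ₁, …, ψ_ℓ)` of `g` can be transformed, by a C∞ diffeomorphism `H̃` between
neighborhoods of `0` in `ℝⁿ × ℝ^ℓ` fixing `0`, into `(g, μ₁|Jg|², …, μ_ℓ|Jg|²)`
near `0`, where `|Jg|(x,λ)² = (x² + α(λ))²`. -/
theorem opening_eq_jacobianSq_opening_cusp (n l : ℕ) (hn : 2 ≤ n) (hl : 1 ≤ l)
    (α : (Fin (n - 1) → ℝ) → ℝ) (hα : ContDiff ℝ ∞ α) (hα0 : α 0 = 0)
    (ψ : Fin l → ℝ × (Fin (n - 1) → ℝ) → ℝ)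
    (hψ : ∀ i, ContDiff ℝ ∞ (ψ i)) (hψ0 : ∀ i, ψ i 0 = 0)
    (hram : ∀ i, ∃ (U : Set (ℝ × (Fin (n - 1) → ℝ)))
      (a : ℝ × (Fin (n - 1) → ℝ) → ℝ),
      U ∈ nhds (0 : ℝ × (Fin (n - 1) → ℝ)) ∧ ContDiff ℝ ∞ a ∧
      ∀ p ∈ U, fderiv ℝ (ψ i) p (1, 0) = a p * (p.1 ^ 2 + α p.2)) :
    ∃ (W W' : Set ((ℝ × (Fin (n - 1) → ℝ)) × (Fin l → ℝ)))
      (H G : (ℝ × (Fin (n - 1) → ℝ)) × (Fin l → ℝ) →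
        (ℝ × (Fin (n - 1) → ℝ)) × (Fin l → ℝ))
      (μ : Fin l → ℝ × (Fin (n - 1) → ℝ) → ℝ)
      (V : Set (ℝ × (Fin (n - 1) → ℝ))),
      IsOpen W ∧ IsOpen W' ∧ (0 : (ℝ × (Fin (n - 1) → ℝ)) × (Fin l → ℝ)) ∈ W ∧
      (0 : (ℝ × (Fin (n - 1) → ℝ)) × (Fin l → ℝ)) ∈ W' ∧
      ContDiffOn ℝ ∞ H W ∧ ContDiffOn ℝ ∞ G W' ∧
      (∀ q ∈ W, H q ∈ W') ∧ (∀ q ∈ W', G q ∈ W) ∧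
      (∀ q ∈ W, G (H q) = q) ∧ (∀ q ∈ W', H (G q) = q) ∧
      H 0 = 0 ∧
      (∀ i, ContDiff ℝ ∞ (μ i)) ∧
      V ∈ nhds (0 : ℝ × (Fin (n - 1) → ℝ)) ∧
      ∀ p ∈ V,
        H ((p.1 ^ 3 / 3 + α p.2 * p.1, p.2), fun i => ψ i p)
          = ((p.1 ^ 3 / 3 + α p.2 * p.1, p.2),
             fun i => μ i p * (p.1 ^ 2 + α p.2) ^ 2) := by
  have hex : ∀ i, ∃ F μ : ℝ × (Fin (n - 1) → ℝ) → ℝ, ContDiff ℝ ∞ F ∧ ContDiff ℝ ∞ μ ∧ F 0 = 0 ∧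
      ∀ᶠ p in nhds (0 : ℝ × (Fin (n - 1) → ℝ)),
        ψ i p = F (p.1 ^ 3 / 3 + α p.2 * p.1, p.2) + μ p * (p.1 ^ 2 + α p.2) ^ 2 := fun i ↦ by
    obtain ⟨U, a, hU, ha, hψa⟩ := hram i
    exact exists_eq_comp_cusp_add_mul_sq hα hα0 (hψ i) (hψ0 i) ha
      (Filter.eventually_of_mem hU hψa)
  choose F μ hF hμ hF0 hFμ using hex
  have hFfst : ∀ i, ContDiff ℝ ∞ (fun q : (ℝ × (Fin (n - 1) → ℝ)) × (Fin l → ℝ) ↦ F i q.1) :=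
    fun i ↦ (hF i).comp contDiff_fst
  have hsnd : ∀ i, ContDiff ℝ ∞ (fun q : (ℝ × (Fin (n - 1) → ℝ)) × (Fin l → ℝ) ↦ q.2 i) :=
    fun i ↦ (contDiff_apply ℝ ℝ i).comp contDiff_snd
  refine ⟨Set.univ, Set.univ, fun q ↦ (q.1, fun i ↦ q.2 i - F i q.1),
    fun q ↦ (q.1, fun i ↦ q.2 i + F i q.1), μ, _, isOpen_univ, isOpen_univ, Set.mem_univ _,
    Set.mem_univ _,
    (contDiff_fst.prodMk (contDiff_pi.2 fun i ↦ (hsnd i).sub (hFfst i))).contDiffOn,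
    (contDiff_fst.prodMk (contDiff_pi.2 fun i ↦ (hsnd i).add (hFfst i))).contDiffOn,
    fun _ _ ↦ Set.mem_univ _, fun _ _ ↦ Set.mem_univ _, fun q _ ↦ by simp, fun q _ ↦ by simp,
    ?_, hμ, Filter.eventually_all.2 hFμ, fun p hp ↦ ?_⟩
  · ext <;> simp [hF0]
  · ext i
    · rfl
    · rfl
    · simp [hp i]
end

section
/- Let n ≥ 2 and ℓ ≥ 1, let α : ℝ^{n−1} → ℝ be a C∞ function with α(0) = 0, and define g(x, λ) = (x²/2 + α(λ)x, λ). Let ψ₁, …, ψ_ℓ : ℝⁿ → ℝ be C∞ functions with ψᵢ(0) = 0 such that for each i there exist a neighborhood of 0 and a C∞ function aᵢ with ∂ψᵢ/∂x(x,λ) = aᵢ(x,λ)·(x + α(λ)) on it. Then there exist open neighborhoods W, W' of 0 in ℝⁿ × ℝ^ℓ, a C∞ diffeomorphism H̃ : W → W' with H̃(0) = 0, C∞ functions μ₁, …, μ_ℓ : ℝⁿ → ℝ, and a neighborhood V of 0 in ℝⁿ such that for all (x, λ) ∈ V, H̃(g(x,λ), ψ₁(x,λ), …, ψ_ℓ(x,λ))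 = (g(x,λ), μ₁(x,λ)·(x + α(λ))², …, μ_ℓ(x,λ)·(x + α(λ))²). -/
open scoped ContDiff

universe u

/-- The derivative of a parametric interval integral of a `C¹` function is the integral of the
partial derivatives. -/
theorem hasFDerivAt_parametric_intervalIntegral {E F : Type*} [NormedAddCommGroup E]
    [NormedSpace ℝ E] [ProperSpace E] [NormedAddCommGroup F] [NormedSpace ℝ F]
    {f : E × ℝ → F} (hf : ContDiff ℝ 1 f) (a b : ℝ) (x₀ : E) :
    HasFDerivAt (fun x => ∫ t in a..b, f (x, t))
      (∫ t in a..b, (fderiv ℝ f (x₀, t)).comp (ContinuousLinearMap.inl ℝ E ℝ)) x₀ := by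
  have hc : Continuous fun q : E × ℝ =>
      (fderiv ℝ f q).comp (ContinuousLinearMap.inl ℝ E ℝ) :=
    (hf.continuous_fderiv one_ne_zero).clm_comp continuous_const
  obtain ⟨C, hC⟩ := ((isCompact_closedBall x₀ 1).prod
    (isCompact_uIcc (a := a) (b := b))).exists_bound_of_continuousOn hc.continuousOn
  refine intervalIntegral.hasFDerivAt_integral_of_dominated_of_fderiv_le
    (F' := fun x t => (fderiv ℝ f (x, t)).comp (ContinuousLinearMap.inl ℝ E ℝ))
    (bound := fun _ => C) (Metric.closedBall_mem_nhds x₀ one_pos) ?_ ?_ ?_ ?_ ?_ ?_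
  · exact Filter.Eventually.of_forall fun x =>
      (hf.continuous.comp (Continuous.prodMk_right x)).aestronglyMeasurable
  · exact (hf.continuous.comp (Continuous.prodMk_right x₀)).intervalIntegrable _ _
  · exact (hc.comp (Continuous.prodMk_right x₀)).aestronglyMeasurable
  · exact Filter.Eventually.of_forall fun t ht x hx =>
      hC (x, t) ⟨hx, Set.uIoc_subset_uIcc ht⟩
  · exact intervalIntegrable_const
  · refine Filter.Eventually.of_forall fun t _ x _ => ?_
    exact ((hf.differentiable one_ne_zero (x, t)).hasFDerivAt).comp x (hasFDerivAt_prodMk_left x t)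

/-- A parametric interval integral of a smooth function is smooth in the parameter. -/
theorem contDiff_parametric_intervalIntegral {E F : Type u} [NormedAddCommGroup E]
    [NormedSpace ℝ E] [ProperSpace E] [NormedAddCommGroup F] [NormedSpace ℝ F]
    {f : E × ℝ → F} (hf : ContDiff ℝ ∞ f) (a b : ℝ) :
    ContDiff ℝ ∞ fun x => ∫ t in a..b, f (x, t) := by
  refine contDiff_infty.2 fun n => ?_
  induction n generalizing F with
  | zero =>
    exact contDiff_zero.2
      (intervalIntegral.continuous_parametric_intervalIntegral_of_continuous'
        (f := fun x t => f (x, t)) hf.continuous a b)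
  | succ n ih =>
    have hd := hasFDerivAt_parametric_intervalIntegral (hf.of_le (by simp)) a b
    push_cast
    refine contDiff_succ_iff_fderiv.2 ⟨fun x => (hd x).differentiableAt, by simp, ?_⟩
    rw [funext fun x => (hd x).fderiv]
    exact ih (f := fun q => (fderiv ℝ f q).comp (ContinuousLinearMap.inl ℝ E ℝ))
      ((hf.fderiv_right (by simp)).clm_comp contDiff_const)

/-- If `∂ψ/∂x = a · (x + α)` along the segment from `(-α, v)` to `(x, v)`, then
`ψ (x, v) - ψ (-α, v)` is `(x + α)²` times an integral of `a` over that segment. -/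
theorem sub_eq_integral_mul_sq_of_fderiv_eq {E : Type*} [NormedAddCommGroup E] [NormedSpace ℝ E]
    {ψ a : ℝ × E → ℝ} (hψ : Differentiable ℝ ψ) (ha : Continuous a) (x c : ℝ) (v : E)
    (h : ∀ u ∈ Set.Icc (0 : ℝ) 1, fderiv ℝ ψ (u * (x + c) - c, v) (1, 0) =
      a (u * (x + c) - c, v) * (u * (x + c))) :
    ψ (x, v) - ψ (-c, v) = (∫ u in (0 : ℝ)..1, u * a (u * (x + c) - c, v)) * (x + c) ^ 2 := by
  have hderiv : ∀ u ∈ Set.uIcc (0 : ℝ) 1, HasDerivAt (fun u : ℝ => ψ (u * (x + c) - c, v))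
      (u * a (u * (x + c) - c, v) * (x + c) ^ 2) u := by
    intro u hu
    rw [Set.uIcc_of_le zero_le_one] at hu
    have hline : HasDerivAt (fun u : ℝ => (u * (x + c) - c, v))
        ((x + c) • ((1 : ℝ), (0 : E))) u := by
      simpa using (((hasDerivAt_id u).mul_const (x + c)).sub_const c).prodMk (hasDerivAt_const u v)
    have := (hψ (u * (x + c) - c, v)).hasFDerivAt.comp_hasDerivAt u hline
    rw [map_smul, h u hu, smul_eq_mul] at this
    exact this.congr_deriv (by ring)
  have hint := intervalIntegral.integral_eq_sub_of_hasDerivAt hderiv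
    (Continuous.intervalIntegrable (by fun_prop) _ _)
  rw [intervalIntegral.integral_mul_const] at hint
  simpa using hint.symm

/-- For `g(x,λ) = (x²/2 + α(λ)x, λ)` with `α(0)=0`, any opening
`(g, ψ₁, …, ψ_ℓ)` of `g` can be transformed, by a C∞ diffeomorphism `H̃` between
neighborhoods of `0` in `ℝⁿ × ℝ^ℓ` fixing `0`, into `(g, μ₁|Jg|², …, μ_ℓ|Jg|²)`
near `0`, where `|Jg|(x,λ)² = (x + α(λ))²`. -/
theorem opening_eq_jacobianSq_opening_fold (n l : ℕ) (hn : 2 ≤ n) (hl : 1 ≤ l)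
    (α : (Fin (n - 1) → ℝ) → ℝ) (hα : ContDiff ℝ ∞ α) (hα0 : α 0 = 0)
    (ψ : Fin l → ℝ × (Fin (n - 1) → ℝ) → ℝ)
    (hψ : ∀ i, ContDiff ℝ ∞ (ψ i)) (hψ0 : ∀ i, ψ i 0 = 0)
    (hram : ∀ i, ∃ (U : Set (ℝ × (Fin (n - 1) → ℝ)))
      (a : ℝ × (Fin (n - 1) → ℝ) → ℝ),
      U ∈ nhds (0 : ℝ × (Fin (n - 1) → ℝ)) ∧ ContDiff ℝ ∞ a ∧
      ∀ p ∈ U, fderiv ℝ (ψ i) p (1, 0) = a p * (p.1 + α p.2)) :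
    ∃ (W W' : Set ((ℝ × (Fin (n - 1) → ℝ)) × (Fin l → ℝ)))
      (H G : (ℝ × (Fin (n - 1) → ℝ)) × (Fin l → ℝ) →
        (ℝ × (Fin (n - 1) → ℝ)) × (Fin l → ℝ))
      (μ : Fin l → ℝ × (Fin (n - 1) → ℝ) → ℝ)
      (V : Set (ℝ × (Fin (n - 1) → ℝ))),
      IsOpen W ∧ IsOpen W' ∧ (0 : (ℝ × (Fin (n - 1) → ℝ)) × (Fin l → ℝ)) ∈ W ∧
      (0 : (ℝ × (Fin (n - 1) → ℝ)) × (Fin l → ℝ)) ∈ W' ∧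
      ContDiffOn ℝ ∞ H W ∧ ContDiffOn ℝ ∞ G W' ∧
      (∀ q ∈ W, H q ∈ W') ∧ (∀ q ∈ W', G q ∈ W) ∧
      (∀ q ∈ W, G (H q) = q) ∧ (∀ q ∈ W', H (G q) = q) ∧
      H 0 = 0 ∧
      (∀ i, ContDiff ℝ ∞ (μ i)) ∧
      V ∈ nhds (0 : ℝ × (Fin (n - 1) → ℝ)) ∧
      ∀ p ∈ V,
        H ((p.1 ^ 2 / 2 + α p.2 * p.1, p.2), fun i => ψ i p)
          = ((p.1 ^ 2 / 2 + α p.2 * p.1, p.2),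
             fun i => μ i p * (p.1 + α p.2) ^ 2) := by
  choose U a hU ha hUa using hram
  have hs : ContDiff ℝ ∞ fun q : (ℝ × (Fin (n - 1) → ℝ)) × (Fin l → ℝ) =>
      fun i => ψ i (-α q.1.2, q.1.2) := by
    refine contDiff_pi.2 fun i => (hψ i).comp ?_
    fun_prop
  obtain ⟨r, hr, hball⟩ := Metric.mem_nhds_iff.1 (Filter.iInter_mem.2 hU)
  have hcont : Continuous fun p : ℝ × (Fin (n - 1) → ℝ) => ((-α p.2, p.2) : ℝ × _) := by
    have := hα.continuous
    fun_prop
  refine ⟨Set.univ, Set.univ, fun q => (q.1, fun i => q.2 i - ψ i (-α q.1.2, q.1.2)),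
    fun q => (q.1, fun i => q.2 i + ψ i (-α q.1.2, q.1.2)),
    fun i p => ∫ u in (0 : ℝ)..1, u * a i (u * (p.1 + α p.2) - α p.2, p.2),
    Metric.ball 0 r ∩ (fun p => (-α p.2, p.2)) ⁻¹' Metric.ball 0 r,
    isOpen_univ, isOpen_univ, trivial, trivial,
    (contDiff_fst.prodMk (contDiff_snd.sub hs)).contDiffOn,
    (contDiff_fst.prodMk (contDiff_snd.add hs)).contDiffOn,
    fun _ _ => trivial, fun _ _ => trivial, fun _ _ => by simp, fun _ _ => by simp, ?_,
    fun i => ?_, ?_, ?_⟩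
  · ext i
    · rfl
    · rfl
    · simpa [hα0, Prod.mk_zero_zero] using hψ0 i
  · refine contDiff_parametric_intervalIntegral
      (f := fun q : (ℝ × (Fin (n - 1) → ℝ)) × ℝ =>
        q.2 * a i (q.2 * (q.1.1 + α q.1.2) - α q.1.2, q.1.2)) ?_ 0 1
    refine contDiff_snd.mul ((ha i).comp ?_)
    fun_prop
  · refine Filter.inter_mem (Metric.ball_mem_nhds 0 hr) (hcont.continuousAt.preimage_mem_nhds ?_)
    simpa [hα0, Prod.mk_zero_zero] using Metric.ball_mem_nhds (0 : ℝ × (Fin (n - 1) → ℝ)) hr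
  · rintro ⟨x, v⟩ ⟨hp, hp'⟩
    refine Prod.ext rfl (funext fun i => ?_)
    refine sub_eq_integral_mul_sq_of_fderiv_eq ((hψ i).differentiable (by simp))
      (ha i).continuous x (α v) v fun u hu => ?_
    have hmem : ((u * (x + α v) - α v, v) : ℝ × (Fin (n - 1) → ℝ)) ∈ Metric.ball 0 r := by
      convert (convex_ball (0 : ℝ × (Fin (n - 1) → ℝ)) r) hp hp' hu.1
        (sub_nonneg.2 hu.2) (by ring) using 1
      ext j
      · simp; ring
      · simp
    simpa using hUa i _ (Set.mem_iInter.1 (hball hmem) i)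
end

section
/- Define F : ℝ² → ℝ³ by F(x, y) = (x²/2 + xy, y, (x + y)²), i.e., F = (f, |Jf|²) for f(x,y) = (x²/2 + xy, y), whose Jacobian determinant is |Jf|(x,y) = x + y. Then F is A-equivalent to the fold normal form: there exist C∞ diffeomorphisms h : ℝ² → ℝ² and H : ℝ³ → ℝ³ with h(0,0) = (0,0) and H(0,0,0) = (0,0,0) such that H(F(h(x, y))) = (x², y, 0) for all (x, y) ∈ ℝ². -/
open scoped ContDiff

/-- The frontal `F(x,y) = (x²/2 + xy, y, (x+y)²) = (f, |Jf|²)`, with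
`f(x,y) = (x²/2 + xy, y)` and `|Jf|(x,y) = x + y`, is A-equivalent to the fold normal
form `(x, y) ↦ (x², y, 0)`. -/
theorem fold_A_equiv
    (F : ℝ × ℝ → ℝ × ℝ × ℝ)
    (hF : ∀ x y : ℝ, F (x, y) = (x ^ 2 / 2 + x * y, y, (x + y) ^ 2)) :
    ∃ (h h' : ℝ × ℝ → ℝ × ℝ) (H H' : ℝ × ℝ × ℝ → ℝ × ℝ × ℝ),
      ContDiff ℝ ∞ h ∧ ContDiff ℝ ∞ h' ∧ ContDiff ℝ ∞ H ∧ ContDiff ℝ ∞ H' ∧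
      (∀ p, h' (h p) = p) ∧ (∀ p, h (h' p) = p) ∧
      (∀ q, H' (H q) = q) ∧ (∀ q, H (H' q) = q) ∧
      h (0, 0) = (0, 0) ∧ H (0, 0, 0) = (0, 0, 0) ∧
      ∀ x y : ℝ, H (F (h (x, y))) = (x ^ 2, y, 0) := by
  refine ⟨fun p => (p.1 - p.2, p.2), fun p => (p.1 + p.2, p.2),
    fun q => (q.2.2, q.2.1, q.2.2 - 2 * q.1 - q.2.1 ^ 2),
    fun q => ((q.1 - q.2.2 - q.2.1 ^ 2) / 2, q.2.1, q.1),
    by fun_prop, by fun_prop, by fun_prop, by fun_prop, ?_, ?_, ?_, ?_, by simp, by simp, ?_⟩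
  · rintro ⟨x, y⟩
    simp
  · rintro ⟨x, y⟩
    simp
  · rintro ⟨x, y, z⟩
    simp only [Prod.mk.injEq, and_true]
    ring
  · rintro ⟨x, y, z⟩
    simp only [Prod.mk.injEq, true_and]
    ring
  · intro x y
    simp only [hF, Prod.mk.injEq, true_and]
    constructor <;> ring
end

section
/- Define F : ℝ² → ℝ³ by F(x, y) = (x²/2 + xy, y, x·(x + y)²), i.e., F = (f, x·|Jf|²) for f(x,y) = (x²/2 + xy, y), whose Jacobian determinant is |Jf|(x,y) = x + y. Then F is A-equivalent to the cuspidal edge: there exist C∞ diffeomorphisms h : ℝ² → ℝ² and H : ℝ³ → ℝ³ with h(0,0) = (0,0) and H(0,0,0) = (0,0,0) such that H(F(h(x, y))) = (x², y, x³) for all (x, y) ∈ ℝ². -/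
open scoped ContDiff

/-- The frontal `F(x,y) = (x²/2 + xy, y, x(x+y)²) = (f, x·|Jf|²)`, with
`f(x,y) = (x²/2 + xy, y)` and `|Jf|(x,y) = x + y`, is A-equivalent to the cuspidal
edge `(x, y) ↦ (x², y, x³)`. -/
theorem cuspidal_edge_A_equiv
    (F : ℝ × ℝ → ℝ × ℝ × ℝ)
    (hF : ∀ x y : ℝ, F (x, y) = (x ^ 2 / 2 + x * y, y, x * (x + y) ^ 2)) :
    ∃ (h h' : ℝ × ℝ → ℝ × ℝ) (H H' : ℝ × ℝ × ℝ → ℝ × ℝ × ℝ),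
      ContDiff ℝ ∞ h ∧ ContDiff ℝ ∞ h' ∧ ContDiff ℝ ∞ H ∧ ContDiff ℝ ∞ H' ∧
      (∀ p, h' (h p) = p) ∧ (∀ p, h (h' p) = p) ∧
      (∀ q, H' (H q) = q) ∧ (∀ q, H (H' q) = q) ∧
      h (0, 0) = (0, 0) ∧ H (0, 0, 0) = (0, 0, 0) ∧
      ∀ x y : ℝ, H (F (h (x, y))) = (x ^ 2, y, x ^ 3) := by
  refine ⟨fun p => (p.1 - p.2, p.2), fun p => (p.1 + p.2, p.2),
    fun q => (2 * q.1 + q.2.1 ^ 2, q.2.1, q.2.2 + q.2.1 * (2 * q.1 + q.2.1 ^ 2)),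
    fun q => ((q.1 - q.2.1 ^ 2) / 2, q.2.1, q.2.2 - q.2.1 * q.1),
    by fun_prop, by fun_prop, by fun_prop, by fun_prop, ?_, ?_, ?_, ?_, ?_, ?_, ?_⟩
  · rintro ⟨x, y⟩
    simp
  · rintro ⟨x, y⟩
    simp
  · rintro ⟨a, b, c⟩
    simp
  · rintro ⟨a, b, c⟩
    ext <;> dsimp only <;> ring
  · simp
  · simp
  · intro x y
    rw [hF]
    ext <;> dsimp only <;> ring
end

section
/- Define F : ℝ² → ℝ³ by F(x, y) = (x²/2 + xy, y, x²·(x + y)²), i.e., F = (f, x²·|Jf|²) for f(x,y) = (x²/2 + xy, y), whose Jacobian determinant is |Jf|(x,y) = x + y. Then F is A-equivalent to the folded umbrella (cuspidal crosscap): there exist C∞ diffeomorphisms h : ℝ² → ℝ² and H : ℝ³ → ℝ³ with h(0,0) = (0,0) and H(0,0,0) = (0,0,0) such that H(F(h(x, y))) = (x², y, x³y) for all (x, y) ∈ ℝ². -/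
open scoped ContDiff

/-- The frontal `F(x,y) = (x²/2 + xy, y, x²(x+y)²) = (f, x²·|Jf|²)`, with
`f(x,y) = (x²/2 + xy, y)` and `|Jf|(x,y) = x + y`, is A-equivalent to the folded
umbrella (cuspidal crosscap) `(x, y) ↦ (x², y, x³y)`. -/
theorem folded_umbrella_A_equiv
    (F : ℝ × ℝ → ℝ × ℝ × ℝ)
    (hF : ∀ x y : ℝ, F (x, y) = (x ^ 2 / 2 + x * y, y, x ^ 2 * (x + y) ^ 2)) :
    ∃ (h h' : ℝ × ℝ → ℝ × ℝ) (H H' : ℝ × ℝ × ℝ → ℝ × ℝ × ℝ),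
      ContDiff ℝ ∞ h ∧ ContDiff ℝ ∞ h' ∧ ContDiff ℝ ∞ H ∧ ContDiff ℝ ∞ H' ∧
      (∀ p, h' (h p) = p) ∧ (∀ p, h (h' p) = p) ∧
      (∀ q, H' (H q) = q) ∧ (∀ q, H (H' q) = q) ∧
      h (0, 0) = (0, 0) ∧ H (0, 0, 0) = (0, 0, 0) ∧
      ∀ x y : ℝ, H (F (h (x, y))) = (x ^ 2, y, x ^ 3 * y) := by
  refine ⟨fun p => (p.1 - p.2, p.2), fun p => (p.1 + p.2, p.2),
    fun q => (2 * q.1 + q.2.1 ^ 2, q.2.1,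
      ((2 * q.1 + q.2.1 ^ 2) ^ 2 + (2 * q.1 + q.2.1 ^ 2) * q.2.1 ^ 2 - q.2.2) / 2),
    fun q => ((q.1 - q.2.1 ^ 2) / 2, q.2.1, q.1 ^ 2 + q.1 * q.2.1 ^ 2 - 2 * q.2.2),
    by fun_prop, by fun_prop, by fun_prop, by fun_prop, ?_, ?_, ?_, ?_, ?_, ?_, ?_⟩
  · rintro ⟨x, y⟩
    simp
  · rintro ⟨x, y⟩
    simp
  · rintro ⟨a, b, c⟩
    ext <;> dsimp only <;> ring
  · rintro ⟨a, b, c⟩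
    ext <;> dsimp only <;> ring
  · simp
  · simp
  · intro x y
    rw [hF]
    ext <;> dsimp only <;> ring
end

section
/- Define F : ℝ² → ℝ⁴ by F(x, y) = (x²/2 + xy, y, x²·(x + y)², x²·(x + y)³), i.e., F = (f, μ₁·|Jf|², μ₂·|Jf|²) with f(x,y) = (x²/2 + xy, y), μ₁(x,y) = x², μ₂(x,y) = x²·(x+y), and |Jf|(x,y) = x + y. Then F is A-equivalent to the open folded umbrella: there exist C∞ diffeomorphisms h : ℝ² → ℝ² and H : ℝ⁴ → ℝ⁴ with h(0,0) = (0,0) and H(0) = 0 such that H(F(h(x, y))) = (x² + xy, y, x⁴ + (2/3)x³y, x⁵ + (5/8)x⁴y) for all (x, y) ∈ ℝ². -/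
open scoped ContDiff

/-- The frontal `F(x,y) = (x²/2 + xy, y, x²(x+y)², x²(x+y)³)
= (f, μ₁|Jf|², μ₂|Jf|²)` with `f(x,y) = (x²/2 + xy, y)`, `μ₁ = x²`, `μ₂ = x²(x+y)`,
`|Jf| = x + y`, is A-equivalent to the open folded umbrella
`(x,y) ↦ (x² + xy, y, x⁴ + (2/3)x³y, x⁵ + (5/8)x⁴y)`. -/
theorem open_folded_umbrella_A_equiv
    (F : ℝ × ℝ → ℝ × ℝ × ℝ × ℝ)
    (hF : ∀ x y : ℝ, F (x, y) =
      (x ^ 2 / 2 + x * y, y, x ^ 2 * (x + y) ^ 2, x ^ 2 * (x + y) ^ 3)) :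
    ∃ (h h' : ℝ × ℝ → ℝ × ℝ) (H H' : ℝ × ℝ × ℝ × ℝ → ℝ × ℝ × ℝ × ℝ),
      ContDiff ℝ ∞ h ∧ ContDiff ℝ ∞ h' ∧ ContDiff ℝ ∞ H ∧ ContDiff ℝ ∞ H' ∧
      (∀ p, h' (h p) = p) ∧ (∀ p, h (h' p) = p) ∧
      (∀ q, H' (H q) = q) ∧ (∀ q, H (H' q) = q) ∧
      h (0, 0) = (0, 0) ∧ H 0 = 0 ∧
      ∀ x y : ℝ, H (F (h (x, y))) =
        (x ^ 2 + x * y, y, x ^ 4 + (2 / 3) * x ^ 3 * y,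
         x ^ 5 + (5 / 8) * x ^ 4 * y) := by
  refine ⟨fun p ↦ (p.1, p.2 / 2), fun p ↦ (p.1, 2 * p.2),
    fun q ↦ (2 * q.1, 2 * q.2.1, 4 / 3 * (q.2.2.1 - q.1 ^ 2),
      q.2.2.2 - 2 * q.2.1 * q.2.2.1 + q.2.1 * q.1 ^ 2),
    fun q ↦ (q.1 / 2, q.2.1 / 2, 3 / 4 * q.2.2.1 + q.1 ^ 2 / 4,
      q.2.2.2 + q.2.1 * (3 / 4 * q.2.2.1 + q.1 ^ 2 / 4) - q.2.1 * q.1 ^ 2 / 8),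
    by fun_prop, by fun_prop, by fun_prop, by fun_prop, ?_, ?_, ?_, ?_, by simp, by simp, ?_⟩
  · rintro ⟨x, y⟩
    ext <;> dsimp only <;> ring
  · rintro ⟨x, y⟩
    ext <;> dsimp only <;> ring
  · rintro ⟨a, b, c, d⟩
    ext <;> dsimp only <;> ring
  · rintro ⟨a, b, c, d⟩
    ext <;> dsimp only <;> ring
  · intro x y
    ext <;> simp only [hF] <;> ring
end

section
/- Define F : ℝ² → ℝ³ by F(x, y) = (x³/3 + xy, y, (x² + y)²), i.e., F = (f, |Jf|²) for f(x,y) = (x³/3 + xy, y), whose Jacobian determinant is |Jf|(x,y) = x² + y. Then F is A-equivalent to the swallowtail: there exist C∞ diffeomorphisms h : ℝ² → ℝ² and H : ℝ³ → ℝ³ with h(0,0) = (0,0) and H(0,0,0) = (0,0,0) such that H(F(h(x, y))) = (−4x³ − 2xy, y, 3x⁴ + x²y) for all (x, y) ∈ ℝ². -/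
open scoped ContDiff

/-- The frontal `F(x,y) = (x³/3 + xy, y, (x²+y)²) = (f, |Jf|²)`, with
`f(x,y) = (x³/3 + xy, y)` and `|Jf|(x,y) = x² + y`, is A-equivalent to the swallowtail
`(x, y) ↦ (−4x³ − 2xy, y, 3x⁴ + x²y)`. -/
theorem swallowtail_A_equiv
    (F : ℝ × ℝ → ℝ × ℝ × ℝ)
    (hF : ∀ x y : ℝ, F (x, y) = (x ^ 3 / 3 + x * y, y, (x ^ 2 + y) ^ 2)) :
    ∃ (h h' : ℝ × ℝ → ℝ × ℝ) (H H' : ℝ × ℝ × ℝ → ℝ × ℝ × ℝ),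
      ContDiff ℝ ∞ h ∧ ContDiff ℝ ∞ h' ∧ ContDiff ℝ ∞ H ∧ ContDiff ℝ ∞ H' ∧
      (∀ p, h' (h p) = p) ∧ (∀ p, h (h' p) = p) ∧
      (∀ q, H' (H q) = q) ∧ (∀ q, H (H' q) = q) ∧
      h (0, 0) = (0, 0) ∧ H (0, 0, 0) = (0, 0, 0) ∧
      ∀ x y : ℝ, H (F (h (x, y))) =
        (-4 * x ^ 3 - 2 * x * y, y, 3 * x ^ 4 + x ^ 2 * y) := by
  refine ⟨fun p => (p.1, p.2 / 6), fun p => (p.1, 6 * p.2),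
    fun q => (-12 * q.1, 6 * q.2.1, 3 * q.2.2 - 3 * q.2.1 ^ 2),
    fun q => (-q.1 / 12, q.2.1 / 6, (q.2.2 + q.2.1 ^ 2 / 12) / 3),
    by fun_prop, by fun_prop, by fun_prop, by fun_prop, ?_, ?_, ?_, ?_, by simp, by simp, ?_⟩
  · rintro ⟨x, y⟩
    ext <;> simp only <;> ring
  · rintro ⟨x, y⟩
    ext <;> simp only <;> ring
  · rintro ⟨x, y, z⟩
    ext <;> simp only <;> ring
  · rintro ⟨x, y, z⟩
    ext <;> simp only <;> ring
  · intro x y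
    simp only [hF]
    ext <;> simp only <;> ring
end

section
/- Define F : ℝ² → ℝ⁴ by F(x, y) = (x³/3 + xy, y, (x² + y)², x·(x² + y)²), i.e., F = (f, μ₁·|Jf|², μ₂·|Jf|²) with f(x,y) = (x³/3 + xy, y), μ₁(x,y) = 1, μ₂(x,y) = x, and |Jf|(x,y) = x² + y. Then F is A-equivalent to the open swallowtail: there exist C∞ diffeomorphisms h : ℝ² → ℝ² and H : ℝ⁴ → ℝ⁴ with h(0,0) = (0,0) and H(0) = 0 such that H(F(h(x, y))) = (x³ + xy, y, x⁴ + (2/3)x²y, x⁵ + (5/9)x³y) for all (x, y) ∈ ℝ². -/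
open scoped ContDiff

/-- The frontal `F(x,y) = (x³/3 + xy, y, (x²+y)², x(x²+y)²)
= (f, μ₁|Jf|², μ₂|Jf|²)` with `f(x,y) = (x³/3 + xy, y)`, `μ₁ = 1`, `μ₂ = x`,
`|Jf| = x² + y`, is A-equivalent to the open swallowtail
`(x,y) ↦ (x³ + xy, y, x⁴ + (2/3)x²y, x⁵ + (5/9)x³y)`. -/
theorem open_swallowtail_A_equiv
    (F : ℝ × ℝ → ℝ × ℝ × ℝ × ℝ)
    (hF : ∀ x y : ℝ, F (x, y) =
      (x ^ 3 / 3 + x * y, y, (x ^ 2 + y) ^ 2, x * (x ^ 2 + y) ^ 2)) :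
    ∃ (h h' : ℝ × ℝ → ℝ × ℝ) (H H' : ℝ × ℝ × ℝ × ℝ → ℝ × ℝ × ℝ × ℝ),
      ContDiff ℝ ∞ h ∧ ContDiff ℝ ∞ h' ∧ ContDiff ℝ ∞ H ∧ ContDiff ℝ ∞ H' ∧
      (∀ p, h' (h p) = p) ∧ (∀ p, h (h' p) = p) ∧
      (∀ q, H' (H q) = q) ∧ (∀ q, H (H' q) = q) ∧
      h (0, 0) = (0, 0) ∧ H 0 = 0 ∧
      ∀ x y : ℝ, H (F (h (x, y))) =
        (x ^ 3 + x * y, y, x ^ 4 + (2 / 3) * x ^ 2 * y,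
         x ^ 5 + (5 / 9) * x ^ 3 * y) := by
  refine ⟨fun p ↦ (p.1, p.2 / 3), fun p ↦ (p.1, 3 * p.2),
    fun q ↦ (3 * q.1, 3 * q.2.1, q.2.2.1 - q.2.1 ^ 2, q.2.2.2 - q.1 * q.2.1),
    fun q ↦ (q.1 / 3, q.2.1 / 3, q.2.2.1 + q.2.1 ^ 2 / 9, q.2.2.2 + q.1 * q.2.1 / 9),
    by fun_prop, by fun_prop, by fun_prop, by fun_prop, ?_, ?_, ?_, ?_, by simp, by simp, ?_⟩
  · rintro ⟨x, y⟩
    ext <;> ring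
  · rintro ⟨x, y⟩
    ext <;> ring
  · rintro ⟨a, b, c, d⟩
    ext <;> ring
  · rintro ⟨a, b, c, d⟩
    ext <;> ring
  · intro x y
    rw [hF]
    ext <;> ring
end

section
/- Let k ≥ 2 be an integer and ε ∈ {1, −1}. Define F : ℝ² → ℝ³ by F(x, y) = (x³/3 + ε·x·y^k, y, (x² + ε·y^k)²), i.e., F = (f, |Jf|²) for f(x,y) = (x³/3 + ε·x·y^k, y), whose Jacobian determinant is |Jf|(x,y) = x² + ε·y^k. Then there exist C∞ diffeomorphisms h : ℝ² → ℝ² and H : ℝ³ → ℝ³ with h(0,0) = (0,0) and H(0,0,0) = (0,0,0) such that H(F(h(x, y))) = (2x³ + ε·x·y^k, y, 3x⁴ + ε·x²·y^k) for all (x, y) ∈ ℝ². In particular, for k = 2 and ε = −1, F is A-equivalent to the double swallowtail (x,y) ↦ (2x³ − xy², y, 3x⁴ − x²y²). -/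
open scoped ContDiff

/-- For `k ≥ 2` and `ε = ±1`, the frontal
`F(x,y) = (x³/3 + εxyᵏ, y, (x² + εyᵏ)²) = (f, |Jf|²)`, with
`f(x,y) = (x³/3 + εxyᵏ, y)` of type `4ₖ` and `|Jf|(x,y) = x² + εyᵏ`, is A-equivalent
to `(x, y) ↦ (2x³ + εxyᵏ, y, 3x⁴ + εx²yᵏ)` (for `k = 2`, `ε = −1`: the double
swallowtail). -/
theorem rieger_4k_opening_A_equiv (k : ℕ) (hk : 2 ≤ k) (ε : ℝ)
    (hε : ε = 1 ∨ ε = -1)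
    (F : ℝ × ℝ → ℝ × ℝ × ℝ)
    (hF : ∀ x y : ℝ, F (x, y) =
      (x ^ 3 / 3 + ε * x * y ^ k, y, (x ^ 2 + ε * y ^ k) ^ 2)) :
    ∃ (h h' : ℝ × ℝ → ℝ × ℝ) (H H' : ℝ × ℝ × ℝ → ℝ × ℝ × ℝ),
      ContDiff ℝ ∞ h ∧ ContDiff ℝ ∞ h' ∧ ContDiff ℝ ∞ H ∧ ContDiff ℝ ∞ H' ∧
      (∀ p, h' (h p) = p) ∧ (∀ p, h (h' p) = p) ∧
      (∀ q, H' (H q) = q) ∧ (∀ q, H (H' q) = q) ∧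
      h (0, 0) = (0, 0) ∧ H (0, 0, 0) = (0, 0, 0) ∧
      ∀ x y : ℝ, H (F (h (x, y))) =
        (2 * x ^ 3 + ε * x * y ^ k, y, 3 * x ^ 4 + ε * x ^ 2 * y ^ k) := by
  have h6 : √(6 : ℝ) ≠ 0 := by positivity
  have hsq : √(6 : ℝ) ^ 2 = 6 := Real.sq_sqrt (by norm_num)
  have hk0 : k ≠ 0 := by omega
  refine ⟨fun p => (√6 * p.1, p.2), fun p => (p.1 / √6, p.2),
    fun q => (q.1 / √6, q.2.1, (q.2.2 - (ε * q.2.1 ^ k) ^ 2) / 12),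
    fun q => (√6 * q.1, q.2.1, 12 * q.2.2 + (ε * q.2.1 ^ k) ^ 2),
    by fun_prop, by fun_prop, by fun_prop, by fun_prop, ?_, ?_, ?_, ?_, by simp,
    by simp [hk0], ?_⟩
  · rintro ⟨x, y⟩
    ext <;> simp [h6]
  · rintro ⟨x, y⟩
    ext <;> simp
    field_simp
  · rintro ⟨a, b, c⟩
    ext <;> simp <;> field_simp
    ring
  · rintro ⟨a, b, c⟩
    ext <;> simp
  · intro x y
    simp only [hF, Prod.mk.injEq, true_and]
    constructor
    · rw [div_eq_iff h6]
      linear_combination (√6 * x ^ 3 / 3) * hsq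
    · linear_combination
        ((√6 ^ 2 + 6) * x ^ 4 + 2 * x ^ 2 * (ε * y ^ k)) / 12 * hsq
end
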